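/- arXiv:2102.05128 — 3 statements merged into one kernel-verified Lean document; each statement's English description precedes it below -/
import Mathlib

section
/- Let γ ⊂ ℙ² be an irreducible conic and let X = 𝕊(ℓ₁,…,ℓ_r), Y = 𝕊(m₁,…,m_s), W = 𝕊(n₁,…,n_t) be contact star configurations on γ defined by r + s + t pairwise distinct tangent lines, with t ≥ r ≥ s ≥ 2 and t ∈ {r+s−1, r+s, r+s+1}. Let P₁, P₂, P₃ be any three non-collinear points of ℙ² and let Z = (t−1)P₁ + (r−1)P₂ + (s−1)P₃ be the fat point scheme with I_Z = I_{P₁}^{t−1} ∩ I_{P₂}^{r−1} ∩ I_{P₃}^{s−1}. Then h_{X∪Y∪W} = h_Z; explicitly, h_{X∪Y∪W}(d) = d+1 for 0 ≤ d ≤ t−2, h_{X∪Y∪W}(d) = r+s−2−2(d−t+1) for t−1 ≤ d ≤ t+s−3, h_{X∪Y∪W}(d) = r−s−(d−(t+s−2)) for t+s−2 ≤ d ≤ t+r−3, and h_{X∪Y∪W}(d) = 0 for d ≥ t+r−2. -/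
open MvPolynomial

noncomputable section

abbrev P2 : Type := Projectivization ℂ (Fin 3 → ℂ)

/-- A line in `ℙ²`: the zero locus of a nonzero linear form. -/
def IsLine (L : Set P2) : Prop :=
  ∃ a : Fin 3 → ℂ, a ≠ 0 ∧ L = {p : P2 | (∑ i, a i * p.rep i) = 0}

/-- An irreducible conic in `ℙ²`: the zero locus of an irreducible homogeneous quadratic form. -/
def IsIrredConic (γ : Set P2) : Prop :=
  ∃ q : MvPolynomial (Fin 3) ℂ, q.IsHomogeneous 2 ∧ Irreducible q ∧
    γ = {p : P2 | eval p.rep q = 0}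

/-- `L` is tangent to `γ` : their intersection is a single point. -/
def IsTangent (L γ : Set P2) : Prop := ∃ p : P2, L ∩ γ = {p}

/-- The star configuration defined by a family of lines: the set of points lying on at
least two of the lines. -/
def starConfig {r : ℕ} (L : Fin r → Set P2) : Set P2 :=
  {p : P2 | ∃ i j : Fin r, i ≠ j ∧ p ∈ L i ∧ p ∈ L j}

/-- A family of lines meets properly: they are distinct lines, no three concurrent. -/
def MeetsProperly {r : ℕ} (L : Fin r → Set P2) : Prop :=
  (∀ i, IsLine (L i)) ∧ Function.Injective L ∧
    ∀ (p : P2) (i j k : Fin r), p ∈ L i → p ∈ L j → p ∈ L k → i = j ∨ i = k ∨ j = k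

/-- `W` is a complete intersection of type `(a,b)`. -/
def IsCI (W : Set P2) (a b : ℕ) : Prop :=
  ∃ F G : MvPolynomial (Fin 3) ℂ, F ≠ 0 ∧ G ≠ 0 ∧
    F.IsHomogeneous a ∧ G.IsHomogeneous b ∧
    {p : P2 | eval p.rep F = 0 ∧ eval p.rep G = 0} = W ∧ W.ncard = a * b

/-- The `ℂ`-submodule of polynomials vanishing at every point of `W`. -/
def vanishingSubmodule (W : Set P2) : Submodule ℂ (MvPolynomial (Fin 3) ℂ) where
  carrier := {F : MvPolynomial (Fin 3) ℂ | ∀ p ∈ W, eval p.rep F = 0}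
  add_mem' := by
    intro a b ha hb p hp
    simp only [map_add, ha p hp, hb p hp, add_zero]
  zero_mem' := by
    intro p hp
    simp
  smul_mem' := by
    intro c F hF p hp
    simp only [smul_eval, hF p hp, mul_zero]

/-- The degree-`d` graded component of the vanishing ideal of `W`. -/
def idealComp (W : Set P2) (d : ℕ) : Submodule ℂ (MvPolynomial (Fin 3) ℂ) :=
  homogeneousSubmodule (Fin 3) ℂ d ⊓ vanishingSubmodule W

/-- The Hilbert function of `W ⊆ ℙ²`. -/
def HF (W : Set P2) (d : ℕ) : ℤ :=
  (Module.finrank ℂ ↥(homogeneousSubmodule (Fin 3) ℂ d) : ℤ) -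
    (Module.finrank ℂ ↥(idealComp W d) : ℤ)

/-- The h-vector of `W ⊆ ℙ²`. -/
def hvec (W : Set P2) : ℕ → ℤ
  | 0 => HF W 0
  | d + 1 => HF W (d + 1) - HF W d

/-- The (affine cone) ideal of a point of `ℙ²`; its powers cut out fat points. -/
def pointIdeal (p : P2) : Ideal (MvPolynomial (Fin 3) ℂ) := RingHom.ker (eval p.rep)

/-- The degree-`d` graded component of a homogeneous ideal `I`. -/
def idealCompI (I : Ideal (MvPolynomial (Fin 3) ℂ)) (d : ℕ) :
    Submodule ℂ (MvPolynomial (Fin 3) ℂ) :=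
  homogeneousSubmodule (Fin 3) ℂ d ⊓ Submodule.restrictScalars ℂ I

/-- The Hilbert function of `S/I`. -/
def HFI (I : Ideal (MvPolynomial (Fin 3) ℂ)) (d : ℕ) : ℤ :=
  (Module.finrank ℂ ↥(homogeneousSubmodule (Fin 3) ℂ d) : ℤ) -
    (Module.finrank ℂ ↥(idealCompI I d) : ℤ)

/-- The h-vector of `S/I`. -/
def hvecI (I : Ideal (MvPolynomial (Fin 3) ℂ)) : ℕ → ℤ
  | 0 => HFI I 0
  | d + 1 => HFI I (d + 1) - HFI I d

/-- The Hadamard-product relation: `R = P ⋆ Q`. -/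
def hadRel (P Q R : P2) : Prop :=
  ∃ (u v : Fin 3 → ℂ) (hu : u ≠ 0) (hv : v ≠ 0) (huv : (fun i => u i * v i) ≠ 0),
    Projectivization.mk ℂ u hu = P ∧ Projectivization.mk ℂ v hv = Q ∧
      Projectivization.mk ℂ (fun i => u i * v i) huv = R

/-- `Δ₀`: points of `ℙ²` with at most one nonzero coordinate. -/
def Δ₀ : Set P2 := {p : P2 | ∃ i : Fin 3, ∀ j : Fin 3, j ≠ i → p.rep j = 0}

section SkewMatrices

open Matrix

variable {n : Type*} [Fintype n]

/-- The skew-symmetric matrices whose range lies in `A`, a model of `⋀² A`. -/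
def skewIn (A : Submodule ℂ (n → ℂ)) : Submodule ℂ (Matrix n n ℂ) where
  carrier := {M | Mᵀ = -M ∧ ∀ x, M *ᵥ x ∈ A}
  add_mem' := by
    rintro M N ⟨hM, hM'⟩ ⟨hN, hN'⟩
    refine ⟨by rw [transpose_add, hM, hN, neg_add], fun x => ?_⟩
    rw [add_mulVec]
    exact A.add_mem (hM' x) (hN' x)
  zero_mem' := ⟨by simp, fun x => by simp⟩
  smul_mem' := by
    rintro c M ⟨hM, hM'⟩
    refine ⟨by rw [transpose_smul, hM, smul_neg], fun x => ?_⟩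
    rw [smul_mulVec]
    exact A.smul_mem c (hM' x)

lemma skewIn_mono {A B : Submodule ℂ (n → ℂ)} (h : A ≤ B) : skewIn A ≤ skewIn B :=
  fun _ hM => ⟨hM.1, fun x => h (hM.2 x)⟩

lemma skewIn_bot : skewIn (⊥ : Submodule ℂ (n → ℂ)) = ⊥ := by
  classical
  refine eq_bot_iff.2 fun M hM => ?_
  rw [Submodule.mem_bot]
  refine ext_of_mulVec_single fun i => ?_
  rw [(Submodule.mem_bot ℂ).1 (hM.2 _), zero_mulVec]

lemma skewIn_inf (A B : Submodule ℂ (n → ℂ)) : skewIn A ⊓ skewIn B = skewIn (A ⊓ B) :=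
  le_antisymm (fun _ hM => ⟨hM.1.1, fun x => ⟨hM.1.2 x, hM.2.2 x⟩⟩)
    (le_inf (skewIn_mono inf_le_left) (skewIn_mono inf_le_right))

lemma skew_dotProduct {M : Matrix n n ℂ} (hM : Mᵀ = -M) (x y : n → ℂ) :
    x ⬝ᵥ M *ᵥ y = -(y ⬝ᵥ M *ᵥ x) := by
  rw [dotProduct_mulVec, ← mulVec_transpose, hM, neg_mulVec, neg_dotProduct, dotProduct_comm]

lemma skew_mulVec_eq_zero {A : Submodule ℂ (n → ℂ)} {M : Matrix n n ℂ} (hM : M ∈ skewIn A)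
    {x : n → ℂ} (hx : ∀ y ∈ A, x ⬝ᵥ y = 0) : M *ᵥ x = 0 := by
  classical
  refine dotProduct_eq_zero _ fun w => ?_
  rw [dotProduct_comm, skew_dotProduct hM.1, hx _ (hM.2 w), neg_zero]

lemma exists_dotProduct_eq_of_disjoint {A B : Submodule ℂ (n → ℂ)} (h : Disjoint A B)
    (x : n → ℂ) : ∃ y : n → ℂ, (∀ a ∈ A, y ⬝ᵥ a = x ⬝ᵥ a) ∧ ∀ b ∈ B, y ⬝ᵥ b = 0 := by
  classical
  obtain ⟨A', hA', hc⟩ := h.exists_isCompl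
  set f : (n → ℂ) →ₗ[ℂ] ℂ := dotProductBilin ℂ ℂ x ∘ₗ A'.projection B hc with hf
  have hy : ∀ v, (fun i => f (Pi.single i 1)) ⬝ᵥ v = f v := by
    intro v
    rw [LinearMap.pi_apply_eq_sum_univ f v, dotProduct]
    refine Finset.sum_congr rfl fun i _ => ?_
    rw [smul_eq_mul, mul_comm]
    congr 3
    ext j
    simp [Pi.single_apply, eq_comm]
  refine ⟨fun i => f (Pi.single i 1), fun a ha => ?_, fun b hb => ?_⟩
  · rw [hy, hf, LinearMap.comp_apply, Submodule.projection_apply_of_mem_left hc (hA' ha)]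
    rfl
  · rw [hy, hf, LinearMap.comp_apply, Submodule.projection_apply_of_mem_right hc hb, map_zero]

/-- Disjointness of `A` and `B` makes a skew matrix in `⋀² A + ⋀² B` split inside `C`. -/
lemma skewIn_sup_inf {A B : Submodule ℂ (n → ℂ)} (h : Disjoint A B) (C : Submodule ℂ (n → ℂ)) :
    (skewIn A ⊔ skewIn B) ⊓ skewIn C = skewIn (A ⊓ C) ⊔ skewIn (B ⊓ C) := by
  refine le_antisymm ?_ (le_inf
    (sup_le_sup (skewIn_mono inf_le_left) (skewIn_mono inf_le_left))
    (sup_le (skewIn_mono inf_le_right) (skewIn_mono inf_le_right)))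
  have key : ∀ {A B : Submodule ℂ (n → ℂ)} (_ : Disjoint A B) {M N : Matrix n n ℂ},
      M ∈ skewIn A → N ∈ skewIn B → M + N ∈ skewIn C → M ∈ skewIn (A ⊓ C) := by
    intro A B h M N hM hN hMN
    refine ⟨hM.1, fun x => ⟨hM.2 x, ?_⟩⟩
    obtain ⟨y, hyA, hyB⟩ := exists_dotProduct_eq_of_disjoint h x
    have h1 : M *ᵥ (x - y) = 0 :=
      skew_mulVec_eq_zero hM fun a ha => by rw [sub_dotProduct, hyA a ha, sub_self]
    have h2 : N *ᵥ y = 0 := skew_mulVec_eq_zero hN hyB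
    have h3 := hMN.2 y
    rw [add_mulVec, h2, add_zero] at h3
    rw [mulVec_sub, sub_eq_zero] at h1
    rwa [h1]
  rintro L ⟨hL, hLC⟩
  obtain ⟨M, hM, N, hN, rfl⟩ := Submodule.mem_sup.1 hL
  exact Submodule.add_mem_sup (key h hM hN hLC) (key h.symm hN hM (by rwa [add_comm]))

/-- Congruence by the columns of `P` parametrizes the skew matrices with range in `range P`. -/
lemma exists_skew_congr {ι : Type*} [Fintype ι] {A : Submodule ℂ (n → ℂ)} (P : Matrix n ι ℂ)
    (hA : A ≤ LinearMap.range P.mulVecLin) {M : Matrix n n ℂ} (hM : M ∈ skewIn A) :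
    ∃ N : Matrix ι ι ℂ, Nᵀ = -N ∧ M = P * N * Pᵀ := by
  classical
  obtain ⟨g, hg⟩ := P.mulVecLin.rangeRestrict.exists_rightInverse_of_surjective
    (LinearMap.range_rangeRestrict _)
  obtain ⟨q, hq⟩ := g.exists_extend
  set Q := LinearMap.toMatrix' q with hQ
  have hPQ : ∀ a ∈ A, P *ᵥ (Q *ᵥ a) = a := by
    intro a ha
    have h1 : Q *ᵥ a = g ⟨a, hA ha⟩ := by
      rw [hQ, LinearMap.toMatrix'_mulVec, ← hq]
      rfl
    have h2 := congrArg Subtype.val (LinearMap.congr_fun hg ⟨a, hA ha⟩)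
    rw [h1]
    exact h2
  have h1 : P * (Q * M) = M := by
    refine ext_of_mulVec_single fun i => ?_
    rw [← mulVec_mulVec, ← mulVec_mulVec, hPQ _ (hM.2 _)]
  have h2 : M * (Qᵀ * Pᵀ) = M := by
    have := congrArg transpose h1
    rw [transpose_mul, transpose_mul, hM.1, Matrix.neg_mul, Matrix.neg_mul, neg_inj,
      Matrix.mul_assoc] at this
    exact this
  refine ⟨Q * M * Qᵀ, ?_, ?_⟩
  · rw [transpose_mul, transpose_mul, transpose_transpose, hM.1, Matrix.neg_mul, Matrix.mul_neg,
      Matrix.mul_assoc]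
  · conv_lhs => rw [← h1, ← h2]
    simp only [Matrix.mul_assoc]

lemma finrank_skewIn_top (r : ℕ) :
    Module.finrank ℂ (skewIn (⊤ : Submodule ℂ (Fin r → ℂ))) = r.choose 2 := by
  let e : skewIn (⊤ : Submodule ℂ (Fin r → ℂ)) ≃ₗ[ℂ]
      ({p : Fin r × Fin r // p.1 < p.2} → ℂ) :=
    { toFun := fun M p => M.1 p.1.1 p.1.2
      map_add' := fun _ _ => rfl
      map_smul' := fun _ _ => rfl
      invFun := fun f => ⟨of fun i j =>
          if h : i < j then f ⟨(i, j), h⟩ else if h : j < i then -f ⟨(j, i), h⟩ else 0, by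
        refine ⟨?_, fun _ => trivial⟩
        ext i j
        rcases lt_trichotomy i j with h | rfl | h
        · simp [h, h.not_gt]
        · simp
        · simp [h, h.not_gt]⟩
      left_inv := by
        rintro ⟨M, hM, -⟩
        have hM' : ∀ i j, M j i = -M i j := fun i j => congrFun (congrFun hM i) j
        ext i j
        rcases lt_trichotomy i j with h | rfl | h
        · simp [h]
        · simpa using (self_eq_neg.1 (hM' i i)).symm
        · simp [h, h.not_gt, hM' i j]
      right_inv := by
        rintro f
        ext ⟨⟨i, j⟩, h⟩
        simp [show i < j from h] }
  rw [e.finrank_eq, Module.finrank_fintype_fun_eq_card, Fintype.card_subtype,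
    Finset.card_filter, Fintype.sum_prod_type_right]
  have h : ∀ j : Fin r, (∑ i : Fin r, if i < j then 1 else 0) = (j : ℕ) := fun j => by
    rw [← Finset.card_filter, Finset.filter_gt_eq_Iio, Fin.card_Iio]
  rw [Finset.sum_congr rfl fun j _ => h j, Fin.sum_univ_eq_sum_range fun j => j,
    Finset.sum_range_id, Nat.choose_two_right]

lemma finrank_skewIn (A : Submodule ℂ (n → ℂ)) :
    Module.finrank ℂ (skewIn A) = (Module.finrank ℂ A).choose 2 := by
  classical
  set r := Module.finrank ℂ A
  set f : (Fin r → ℂ) →ₗ[ℂ] (n → ℂ) :=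
    A.subtype ∘ₗ (Module.finBasis ℂ A).equivFun.symm.toLinearMap with hf
  have hfi : Function.Injective f :=
    A.injective_subtype.comp (Module.finBasis ℂ A).equivFun.symm.injective
  have hfr : LinearMap.range f = A := by
    rw [hf, LinearMap.range_comp, LinearEquiv.range, Submodule.map_top, Submodule.range_subtype]
  set P := LinearMap.toMatrix' f with hP
  have hPf : P.mulVecLin = f := Matrix.toLin'_toMatrix' f
  obtain ⟨q, hq⟩ := f.exists_leftInverse_of_injective (LinearMap.ker_eq_bot.2 hfi)
  set Q := LinearMap.toMatrix' q with hQ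
  have hQP : Q * P = 1 := by rw [hQ, hP, ← LinearMap.toMatrix'_comp, hq, LinearMap.toMatrix'_id]
  have hPQ : Pᵀ * Qᵀ = 1 := by rw [← transpose_mul, hQP, transpose_one]
  let F : Matrix (Fin r) (Fin r) ℂ →ₗ[ℂ] Matrix n n ℂ :=
    { toFun := fun N => P * N * Pᵀ
      map_add' := fun M N => by rw [Matrix.mul_add, Matrix.add_mul]
      map_smul' := fun c N => by simp }
  have hF : Function.Injective F := by
    intro M N h
    have h' : ∀ M : Matrix (Fin r) (Fin r) ℂ, Q * (P * M * Pᵀ) * Qᵀ = M := fun M => by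
      rw [Matrix.mul_assoc P, ← Matrix.mul_assoc Q, hQP, Matrix.one_mul, Matrix.mul_assoc, hPQ,
        Matrix.mul_one]
    rw [← h' M, ← h' N]
    exact congrArg (fun X => Q * X * Qᵀ) h
  have hmap : (skewIn ⊤).map F = skewIn A := by
    refine le_antisymm ?_ fun M hM => ?_
    · rintro _ ⟨N, hN, rfl⟩
      refine ⟨?_, fun x => ?_⟩
      · change (P * N * Pᵀ)ᵀ = -(P * N * Pᵀ)
        rw [transpose_mul, transpose_mul, transpose_transpose, hN.1, Matrix.neg_mul,
          Matrix.mul_neg, Matrix.mul_assoc]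
      · change (P * N * Pᵀ) *ᵥ x ∈ A
        rw [Matrix.mul_assoc, ← mulVec_mulVec, ← hfr, ← hPf]
        exact ⟨_, rfl⟩
    · obtain ⟨N, hN, rfl⟩ := exists_skew_congr P (by rw [hPf, hfr]) hM
      exact ⟨N, ⟨hN, fun _ => trivial⟩, rfl⟩
  rw [← hmap, ← (Submodule.equivMapOfInjective F hF _).finrank_eq, finrank_skewIn_top]

/-- The pairing of two skew matrices. -/
def skewPairing : LinearMap.BilinForm ℂ (skewIn (⊤ : Submodule ℂ (n → ℂ))) :=
  LinearMap.mk₂ ℂ (fun M N => trace (M.1ᵀ * N.1))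
    (fun M M' N => by simp [Matrix.add_mul]) (fun c M N => by simp)
    (fun M N N' => by simp [Matrix.mul_add]) (fun c M N => by simp)

/-- The elementary skew matrix `x ∧ y`. -/
def wedgeMatrix (x y : n → ℂ) : Matrix n n ℂ := vecMulVec x y - vecMulVec y x

lemma wedgeMatrix_mem {A : Submodule ℂ (n → ℂ)} {x y : n → ℂ} (hx : x ∈ A) (hy : y ∈ A) :
    wedgeMatrix x y ∈ skewIn A := by
  refine ⟨by simp [wedgeMatrix, transpose_vecMulVec], fun z => ?_⟩
  rw [wedgeMatrix, sub_mulVec, vecMulVec_mulVec, vecMulVec_mulVec]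
  exact A.sub_mem (by simpa using A.smul_mem _ hx) (by simpa using A.smul_mem _ hy)

lemma trace_mul_wedgeMatrix {M : Matrix n n ℂ} (hM : Mᵀ = -M) (x y : n → ℂ) :
    trace (Mᵀ * wedgeMatrix x y) = 2 * (x ⬝ᵥ M *ᵥ y) := by
  rw [wedgeMatrix, Matrix.mul_sub, trace_sub, mul_vecMulVec, mul_vecMulVec, trace_vecMulVec,
    trace_vecMulVec, hM, neg_mulVec, neg_mulVec, neg_dotProduct, neg_dotProduct,
    dotProduct_comm _ y, dotProduct_comm _ x, skew_dotProduct hM y x]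
  ring

lemma skew_orthogonal_iff {ι : Type*} [Fintype ι] (v : ι → n → ℂ) {M : Matrix n n ℂ}
    (hM : Mᵀ = -M) :
    (∀ N ∈ skewIn (Submodule.span ℂ (Set.range v)), trace (Mᵀ * N) = 0) ↔
      ∀ i j, v i ⬝ᵥ M *ᵥ v j = 0 := by
  classical
  constructor
  · intro h i j
    have := h _ (wedgeMatrix_mem (Submodule.subset_span ⟨i, rfl⟩) (Submodule.subset_span ⟨j, rfl⟩))
    rw [trace_mul_wedgeMatrix hM] at this
    simpa using this
  · intro h N hN
    set P : Matrix n ι ℂ := of fun a i => v i a with hP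
    have hr : LinearMap.range P.mulVecLin = Submodule.span ℂ (Set.range v) := by
      rw [range_mulVecLin]
      rfl
    obtain ⟨K, -, rfl⟩ := exists_skew_congr P hr.ge hN
    have h0 : Pᵀ * (M * P) = 0 := by
      ext i j
      exact h i j
    have h1 : Pᵀ * Mᵀ * P = 0 := by
      rw [hM, Matrix.mul_assoc, Matrix.neg_mul, Matrix.mul_neg, h0, neg_zero]
    rw [← Matrix.mul_assoc, trace_mul_comm, ← Matrix.mul_assoc, ← Matrix.mul_assoc, h1,
      Matrix.zero_mul, trace_zero]

lemma skewPairing_ker :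
    (skewPairing : LinearMap.BilinForm ℂ (skewIn (⊤ : Submodule ℂ (n → ℂ)))).ker = ⊥ := by
  classical
  refine eq_bot_iff.2 fun M hM => ?_
  have h := (skew_orthogonal_iff (fun i : n => (Pi.single i 1 : n → ℂ)) M.2.1).1 fun N hN =>
    LinearMap.congr_fun (LinearMap.mem_ker.1 hM) ⟨N, skewIn_mono le_top hN⟩
  rw [Submodule.mem_bot]
  ext i j
  simpa using h i j

/-- The skew forms vanishing on three families of vectors, as an orthogonal complement. -/
lemma finrank_add_finrank_skew_vanishing {ι₁ ι₂ ι₃ : Type*} [Fintype ι₁] [Fintype ι₂] [Fintype ι₃]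
    (a : ι₁ → n → ℂ) (b : ι₂ → n → ℂ) (c : ι₃ → n → ℂ) {K : Submodule ℂ (Matrix n n ℂ)}
    (hK : ∀ M, M ∈ K ↔ Mᵀ = -M ∧ (∀ i j, a i ⬝ᵥ M *ᵥ a j = 0) ∧
      (∀ i j, b i ⬝ᵥ M *ᵥ b j = 0) ∧ ∀ i j, c i ⬝ᵥ M *ᵥ c j = 0) :
    Module.finrank ℂ ↥(skewIn (Submodule.span ℂ (Set.range a)) ⊔
      skewIn (Submodule.span ℂ (Set.range b)) ⊔ skewIn (Submodule.span ℂ (Set.range c))) +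
      Module.finrank ℂ K = (Fintype.card n).choose 2 := by
  set W := skewIn (Submodule.span ℂ (Set.range a)) ⊔
      skewIn (Submodule.span ℂ (Set.range b)) ⊔ skewIn (Submodule.span ℂ (Set.range c)) with hW
  set T := skewIn (⊤ : Submodule ℂ (n → ℂ)) with hT
  have hWT : W ≤ T :=
    sup_le (sup_le (skewIn_mono le_top) (skewIn_mono le_top)) (skewIn_mono le_top)
  have hKT : K ≤ T := fun M hM => ⟨((hK M).1 hM).1, fun _ => trivial⟩
  have horth : LinearMap.BilinForm.orthogonal skewPairing (W.comap T.subtype) =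
      K.comap T.subtype := by
    have htr : ∀ M N : Matrix n n ℂ, trace (Mᵀ * N) = trace (Nᵀ * M) := fun M N => by
      rw [← trace_transpose, transpose_mul, transpose_transpose]
    ext ⟨M, hM⟩
    rw [Submodule.mem_comap, Submodule.subtype_apply, hK, ← skew_orthogonal_iff a hM.1,
      ← skew_orthogonal_iff b hM.1, ← skew_orthogonal_iff c hM.1,
      LinearMap.BilinForm.mem_orthogonal_iff]
    constructor
    · intro h
      have h' : ∀ N ∈ W, trace (Mᵀ * N) = 0 := fun N hN => by
        rw [htr]
        exact h ⟨N, hWT hN⟩ hN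
      exact ⟨hM.1, fun N hN => h' N (Submodule.mem_sup_left (Submodule.mem_sup_left hN)),
        fun N hN => h' N (Submodule.mem_sup_left (Submodule.mem_sup_right hN)),
        fun N hN => h' N (Submodule.mem_sup_right hN)⟩
    · rintro ⟨-, h1, h2, h3⟩ ⟨N, _⟩ hN
      change trace (Nᵀ * M) = 0
      rw [htr]
      obtain ⟨N', hN', N₃, hN₃, rfl⟩ := Submodule.mem_sup.1 (show N ∈ W from hN)
      obtain ⟨N₁, hN₁, N₂, hN₂, rfl⟩ := Submodule.mem_sup.1 hN'
      rw [Matrix.mul_add, Matrix.mul_add, trace_add, trace_add, h1 _ hN₁, h2 _ hN₂, h3 _ hN₃]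
      simp
  have h := LinearMap.BilinForm.finrank_add_finrank_orthogonal' (B := skewPairing)
    (W.comap T.subtype)
  rw [skewPairing_ker, inf_bot_eq, finrank_bot, add_zero, horth,
    (Submodule.comapSubtypeEquivOfLe hWT).finrank_eq,
    (Submodule.comapSubtypeEquivOfLe hKT).finrank_eq, finrank_skewIn, finrank_top,
    Module.finrank_fintype_fun_eq_card] at h
  exact h

lemma finrank_skewIn_sup {A B : Submodule ℂ (n → ℂ)} (h : Disjoint A B)
    (C : Submodule ℂ (n → ℂ)) :
    Module.finrank ℂ ↥(skewIn A ⊔ skewIn B ⊔ skewIn C) +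
        ((Module.finrank ℂ ↥(A ⊓ C)).choose 2 + (Module.finrank ℂ ↥(B ⊓ C)).choose 2) =
      (Module.finrank ℂ A).choose 2 + (Module.finrank ℂ B).choose 2 +
        (Module.finrank ℂ C).choose 2 := by
  have h1 := Submodule.finrank_sup_add_finrank_inf_eq (skewIn A ⊔ skewIn B) (skewIn C)
  have h2 := Submodule.finrank_sup_add_finrank_inf_eq (skewIn A) (skewIn B)
  have h3 := Submodule.finrank_sup_add_finrank_inf_eq (skewIn (A ⊓ C)) (skewIn (B ⊓ C))
  rw [skewIn_inf, h.eq_bot, skewIn_bot, finrank_bot] at h2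
  rw [skewIn_inf, (h.mono inf_le_left inf_le_left).eq_bot, skewIn_bot, finrank_bot] at h3
  rw [skewIn_sup_inf h] at h1
  simp only [finrank_skewIn] at h1 h2 h3
  omega

end SkewMatrices

section Vandermonde

open Matrix

/-- The point `[w^(n-1), u w^(n-2), …, u^(n-1)]` of the rational normal curve. -/
def powVec (n : ℕ) (u w : ℂ) : Fin n → ℂ := fun j => u ^ (j : ℕ) * w ^ (j.rev : ℕ)

variable {ι : Type*} [Fintype ι] {u w : ι → ℂ}

lemma linearIndependent_powVec_of_card_eq {n : ℕ} (hn : Fintype.card ι = n)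
    (h : ∀ i j, i ≠ j → u i * w j ≠ u j * w i) :
    LinearIndependent ℂ fun i => powVec n (u i) (w i) := by
  classical
  set e := (Fintype.equivFinOfCardEq hn).symm
  refine (linearIndependent_equiv e).1 ?_
  have : (projVandermonde (u ∘ e) (w ∘ e)).det ≠ 0 := by
    rw [det_projVandermonde]
    refine Finset.prod_ne_zero_iff.2 fun i _ => Finset.prod_ne_zero_iff.2 fun j hj => ?_
    rw [sub_ne_zero]
    exact h _ _ (e.injective.ne (Finset.mem_Ioi.1 hj).ne')
  exact linearIndependent_rows_iff_isUnit.2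
    ((Matrix.isUnit_iff_isUnit_det _).2 (isUnit_iff_ne_zero.2 this))

lemma linearIndependent_powVec {n : ℕ} (hn : Fintype.card ι ≤ n)
    (h0 : ∀ i, u i ≠ 0 ∨ w i ≠ 0) (h : ∀ i j, i ≠ j → u i * w j ≠ u j * w i) :
    LinearIndependent ℂ fun i => powVec n (u i) (w i) := by
  classical
  have hinf : (Set.range fun i => u i / w i)ᶜ.Infinite := (Set.finite_range _).infinite_compl
  let x : Fin (n - Fintype.card ι) → ℂ := fun k => hinf.natEmbedding _ k
  have hx : ∀ k i, x k * w i ≠ u i := by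
    intro k i hk
    by_cases hw : w i = 0
    · exact (h0 i).elim (fun hu => hu (by rw [← hk, hw, mul_zero])) fun h => h hw
    · exact (hinf.natEmbedding _ k).2 ⟨i, by rw [div_eq_iff hw, ← hk]⟩
  have key := linearIndependent_powVec_of_card_eq (ι := ι ⊕ Fin (n - Fintype.card ι))
    (u := Sum.elim u x) (w := Sum.elim w 1) (n := n) (by simp [hn]) (by
      rintro (i | i) (j | j) hij
      · exact h i j (by simpa using hij)
      · simpa using (hx j i).symm
      · simpa using hx i j
      · simp only [Sum.elim_inr, Pi.one_apply, mul_one]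
        intro hxx
        refine hij (congrArg _ (Fin.ext ((hinf.natEmbedding _).injective (Subtype.ext hxx)))))
  exact key.comp Sum.inl Sum.inl_injective

lemma span_powVec_eq_top {n : ℕ} (hn : n ≤ Fintype.card ι)
    (h : ∀ i j, i ≠ j → u i * w j ≠ u j * w i) :
    Submodule.span ℂ (Set.range fun i => powVec n (u i) (w i)) = ⊤ := by
  classical
  obtain ⟨f⟩ : Nonempty (Fin n ↪ ι) := Function.Embedding.nonempty_of_card_le (by simpa)
  have h1 := linearIndependent_powVec_of_card_eq (u := u ∘ f) (w := w ∘ f)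
    (n := n) (by simp) fun i j hij => h _ _ (f.injective.ne hij)
  have h2 := h1.span_eq_top_of_card_eq_finrank' (by simp)
  refine top_le_iff.1 (h2.ge.trans (Submodule.span_mono ?_))
  rintro _ ⟨i, rfl⟩
  exact ⟨f i, rfl⟩

lemma finrank_span_powVec (n : ℕ)
    (h0 : ∀ i, u i ≠ 0 ∨ w i ≠ 0) (h : ∀ i j, i ≠ j → u i * w j ≠ u j * w i) :
    Module.finrank ℂ (Submodule.span ℂ (Set.range fun i => powVec n (u i) (w i))) =
      min (Fintype.card ι) n := by
  rcases le_total (Fintype.card ι) n with hn | hn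
  · rw [finrank_span_eq_card (linearIndependent_powVec hn h0 h), min_eq_left hn]
  · rw [span_powVec_eq_top hn h, finrank_top, Module.finrank_fintype_fun_eq_card,
      Fintype.card_fin, min_eq_right hn]

lemma finrank_span_powVec_inf {κ : Type*} [Fintype κ] {u' w' : κ → ℂ} (n : ℕ)
    (h0 : ∀ i, u i ≠ 0 ∨ w i ≠ 0) (h : ∀ i j, i ≠ j → u i * w j ≠ u j * w i)
    (h0' : ∀ i, u' i ≠ 0 ∨ w' i ≠ 0) (h' : ∀ i j, i ≠ j → u' i * w' j ≠ u' j * w' i)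
    (hh : ∀ i j, u i * w' j ≠ u' j * w i) :
    min (Fintype.card ι + Fintype.card κ) n +
      Module.finrank ℂ ↥(Submodule.span ℂ (Set.range fun i => powVec n (u i) (w i)) ⊓
        Submodule.span ℂ (Set.range fun i => powVec n (u' i) (w' i))) =
      min (Fintype.card ι) n + min (Fintype.card κ) n := by
  rw [← finrank_span_powVec n h0 h, ← finrank_span_powVec n h0' h',
    ← Submodule.finrank_sup_add_finrank_inf_eq, ← Submodule.span_union, ← Fintype.card_sum,
    ← finrank_span_powVec (u := Sum.elim u u') (w := Sum.elim w w') n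
      (by rintro (i | i) <;> simp [h0, h0'])]
  · have : (Set.range fun i => powVec n (Sum.elim u u' i) (Sum.elim w w' i)) =
        (Set.range fun i => powVec n (u i) (w i)) ∪ Set.range fun i => powVec n (u' i) (w' i) := by
      ext v
      simp
    rw [this]
  · rintro (i | i) (j | j) hij
    · exact h i j (by simpa using hij)
    · exact hh i j
    · exact (hh j i).symm
    · exact h' i j (by simpa using hij)

end Vandermonde

section SkewForms

open Matrix

/-- The point of `ℂ³` whose coordinates are the symmetric functions of `[u : w]`, `[u' : w']`. -/
def symPoint (u w u' w' : ℂ) : Fin 3 → ℂ := ![u * u', u * w' + u' * w, w * w']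

/-- The linear form computing the `i`-th coordinate of `T`. -/
def coordForm (T : (Fin 3 → ℂ) ≃ₗ[ℂ] (Fin 3 → ℂ)) (i : Fin 3) : MvPolynomial (Fin 3) ℂ :=
  ∑ j, C (T (Pi.single j 1) i) * X j

lemma coordForm_isHomogeneous (T : (Fin 3 → ℂ) ≃ₗ[ℂ] (Fin 3 → ℂ)) (i : Fin 3) :
    (coordForm T i).IsHomogeneous 1 :=
  IsHomogeneous.sum _ _ _ fun j _ => by
    simpa using (isHomogeneous_C (Fin 3) (T (Pi.single j 1) i)).mul (isHomogeneous_X ℂ j)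

lemma eval_coordForm (T : (Fin 3 → ℂ) ≃ₗ[ℂ] (Fin 3 → ℂ)) (i : Fin 3) (x : Fin 3 → ℂ) :
    eval x (coordForm T i) = T x i := by
  conv_rhs => rw [pi_eq_sum_univ' x]
  simp [coordForm, mul_comm]

/-- Complete homogeneous symmetric polynomial of degree `m` in two quantities with sum `y` and
product `x * z`. -/
def hsymmTwo {R : Type*} [CommRing R] (x y z : R) : ℕ → R
  | 0 => 1
  | 1 => y
  | m + 2 => y * hsymmTwo x y z (m + 1) - x * z * hsymmTwo x y z m

lemma hsymmTwo_mul_sub {R : Type*} [CommRing R] {x y z p q : R} (hs : y = p + q)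
    (hp : x * z = p * q) : ∀ m, hsymmTwo x y z m * (p - q) = p ^ (m + 1) - q ^ (m + 1)
  | 0 => by simp [hsymmTwo]
  | 1 => by rw [hsymmTwo, hs]; ring
  | m + 2 => by
    rw [hsymmTwo, sub_mul, mul_assoc, mul_assoc, hsymmTwo_mul_sub hs hp (m + 1),
      hsymmTwo_mul_sub hs hp m, hs, hp]
    ring

lemma map_hsymmTwo {R S : Type*} [CommRing R] [CommRing S] (f : R →+* S) (x y z : R) :
    ∀ m, f (hsymmTwo x y z m) = hsymmTwo (f x) (f y) (f z) m
  | 0 => by simp [hsymmTwo]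
  | 1 => by simp [hsymmTwo]
  | m + 2 => by simp [hsymmTwo, map_hsymmTwo f x y z m, map_hsymmTwo f x y z (m + 1)]

lemma hsymmTwo_isHomogeneous {x y z : MvPolynomial (Fin 3) ℂ} (hx : x.IsHomogeneous 1)
    (hy : y.IsHomogeneous 1) (hz : z.IsHomogeneous 1) :
    ∀ m, (hsymmTwo x y z m).IsHomogeneous m
  | 0 => isHomogeneous_one _ _
  | 1 => hy
  | m + 2 => by
    have h1 := hy.mul (hsymmTwo_isHomogeneous hx hy hz (m + 1))
    have h2 := (hx.mul hz).mul (hsymmTwo_isHomogeneous hx hy hz m)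
    rw [show 1 + (m + 1) = m + 2 by ring] at h1
    rw [show 1 + 1 + m = m + 2 by ring] at h2
    exact h1.sub h2

variable (T : (Fin 3 → ℂ) ≃ₗ[ℂ] (Fin 3 → ℂ))

/-- The plane curve attached to a skew bilinear form on binary forms. -/
def skewToForm (d : ℕ) : Matrix (Fin (d + 2)) (Fin (d + 2)) ℂ →ₗ[ℂ] MvPolynomial (Fin 3) ℂ where
  toFun M := ∑ i, ∑ j, if i < j then M i j • (coordForm T 0 ^ (i : ℕ) *
    hsymmTwo (coordForm T 0) (coordForm T 1) (coordForm T 2) (j - i - 1 : ℕ) *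
      coordForm T 2 ^ (d + 1 - j : ℕ)) else 0
  map_add' M N := by
    simp only [← Finset.sum_add_distrib]
    refine Finset.sum_congr rfl fun i _ => Finset.sum_congr rfl fun j _ => ?_
    split_ifs <;> simp [add_smul]
  map_smul' c M := by
    simp only [Finset.smul_sum]
    refine Finset.sum_congr rfl fun i _ => Finset.sum_congr rfl fun j _ => ?_
    split_ifs <;> simp [mul_smul]

lemma skewToForm_isHomogeneous {d : ℕ} (M : Matrix (Fin (d + 2)) (Fin (d + 2)) ℂ) :
    (skewToForm T d M).IsHomogeneous d := by
  refine IsHomogeneous.sum _ _ _ fun i _ => IsHomogeneous.sum _ _ _ fun j _ => ?_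
  split_ifs with hij
  · rw [smul_eq_C_mul]
    have h := (((isHomogeneous_C (Fin 3) (M i j)).mul
      (((coordForm_isHomogeneous T 0).pow i).mul (hsymmTwo_isHomogeneous
        (coordForm_isHomogeneous T 0) (coordForm_isHomogeneous T 1)
        (coordForm_isHomogeneous T 2) (j - i - 1)))).mul
        ((coordForm_isHomogeneous T 2).pow (d + 1 - j)))
    rw [mul_assoc] at h
    convert h using 1
    have : (i : ℕ) < j := hij
    omega
  · exact isHomogeneous_zero _ _ _

lemma eval_skewToForm {d : ℕ} {M : Matrix (Fin (d + 2)) (Fin (d + 2)) ℂ} (hM : Mᵀ = -M)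
    (u w u' w' : ℂ) :
    eval (T.symm (symPoint u w u' w')) (skewToForm T d M) *
      (u * w' - u' * w) =
      -(powVec (d + 2) u w ⬝ᵥ M *ᵥ powVec (d + 2) u' w') := by
  have hM' : ∀ i j, M j i = -M i j := fun i j => congrFun (congrFun hM i) j
  have h1 : ∀ i j : Fin (d + 2), i < j →
      eval (T.symm (symPoint u w u' w')) (coordForm T 0 ^ (i : ℕ) *
        hsymmTwo (coordForm T 0) (coordForm T 1) (coordForm T 2) (j - i - 1 : ℕ) *
        coordForm T 2 ^ (d + 1 - j : ℕ)) * (u * w' - u' * w) =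
      powVec (d + 2) u w j * powVec (d + 2) u' w' i -
        powVec (d + 2) u w i * powVec (d + 2) u' w' j := by
    intro i j hij
    obtain ⟨k, hk⟩ := Nat.exists_eq_add_of_lt (show (i : ℕ) < j from hij)
    obtain ⟨l, hl⟩ := Nat.exists_eq_add_of_le (show (j : ℕ) ≤ d + 1 by omega)
    have e1 : (j - i - 1 : ℕ) = k := by omega
    have e2 : (d + 1 - j : ℕ) = l := by omega
    have e3 : d + 2 - ((i : ℕ) + 1) = k + 1 + l := by omega
    have e4 : d + 2 - ((i : ℕ) + k + 1 + 1) = l := by omega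
    have h2 := hsymmTwo_mul_sub (x := u * u') (y := u * w' + u' * w)
      (z := w * w') (p := u * w') (q := u' * w) rfl (by ring) k
    rw [map_mul, map_mul, map_pow, map_pow, map_hsymmTwo, eval_coordForm, eval_coordForm,
      eval_coordForm, LinearEquiv.apply_symm_apply, e1, e2]
    simp only [symPoint, cons_val, powVec, Fin.val_rev, hk, e3, e4]
    linear_combination (u * u') ^ (i : ℕ) * (w * w') ^ l * h2
  have h3 : ∀ f : Fin (d + 2) → Fin (d + 2) → ℂ, (∀ i, f i i = 0) →
      ∑ i, ∑ j, f i j = ∑ i, ∑ j, if i < j then f i j + f j i else 0 := by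
    intro f hf
    have e1 : ∀ i j : Fin (d + 2), f i j = (if i < j then f i j else 0) +
        (if j < i then f i j else 0) := by
      intro i j
      rcases lt_trichotomy i j with h | rfl | h
      · simp [h, h.not_gt]
      · simp [hf]
      · simp [h, h.not_gt]
    have e2 : ∀ i j : Fin (d + 2), (if i < j then f i j + f j i else 0) =
        (if i < j then f i j else 0) + (if i < j then f j i else 0) := by
      intro i j
      split_ifs <;> simp
    rw [Finset.sum_congr rfl fun i _ => Finset.sum_congr rfl fun j _ => e1 i j]
    simp only [e2, Finset.sum_add_distrib]
    rw [Finset.sum_comm (f := fun i j => if j < i then f i j else 0)]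
  have h4 : powVec (d + 2) u w ⬝ᵥ M *ᵥ powVec (d + 2) u' w' =
      ∑ i, ∑ j, powVec (d + 2) u w i *
        (M i j * powVec (d + 2) u' w' j) := by
    simp only [dotProduct, mulVec, Finset.mul_sum]
  rw [h4, h3 _ fun i => by rw [self_eq_neg.1 (hM' i i), zero_mul, mul_zero], skewToForm,
    LinearMap.coe_mk, AddHom.coe_mk, map_sum, Finset.sum_mul, ← Finset.sum_neg_distrib]
  refine Finset.sum_congr rfl fun i _ => ?_
  rw [map_sum, Finset.sum_mul, ← Finset.sum_neg_distrib]
  refine Finset.sum_congr rfl fun j _ => ?_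
  split_ifs with hij
  · rw [smul_eval, mul_assoc, h1 i j hij, hM' i j]
    ring
  · simp

end SkewForms

section Monomials

/-- The exponents of degree `d` that are coordinatewise at least `(a, b, c)`. -/
def expGE (d a b c : ℕ) : Finset (Fin 3 →₀ ℕ) :=
  {x ∈ Finset.univ.finsuppAntidiag d | a ≤ x 0 ∧ b ≤ x 1 ∧ c ≤ x 2}

lemma mem_expGE {d a b c : ℕ} {x : Fin 3 →₀ ℕ} :
    x ∈ expGE d a b c ↔ x 0 + x 1 + x 2 = d ∧ a ≤ x 0 ∧ b ≤ x 1 ∧ c ≤ x 2 := by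
  simp [expGE, Fin.sum_univ_three]

lemma card_expGE (d a b c : ℕ) : (expGE d a b c).card = (d + 2 - (a + b + c)).choose 2 := by
  rcases le_or_gt (a + b + c) d with h | h
  · obtain ⟨e, rfl⟩ := Nat.exists_eq_add_of_le h
    have h1 : ((Finset.univ : Finset (Fin 3)).finsuppAntidiag e).card = (e + 2).choose 2 := by
      rw [Finset.card_finsuppAntidiag_nat_eq_choose, Finset.card_univ, Fintype.card_fin,
        show 3 + e - 1 = e + 2 by omega, ← Nat.choose_symm (by omega), Nat.add_sub_cancel_left]
    rw [show a + b + c + e + 2 - (a + b + c) = e + 2 by omega, ← h1]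
    obtain ⟨v, h0, h1, h2⟩ : ∃ v : Fin 3 →₀ ℕ, v 0 = a ∧ v 1 = b ∧ v 2 = c :=
      ⟨Finsupp.equivFunOnFinite.symm ![a, b, c], rfl, rfl, rfl⟩
    symm
    refine Finset.card_bij (fun x _ => x + v)
      (fun x hx => ?_) (fun x _ y _ hxy => add_right_cancel hxy) fun x hx => ?_
    · rw [mem_expGE]
      simp [Fin.sum_univ_three] at hx ⊢
      omega
    · rw [mem_expGE] at hx
      refine ⟨x - v, ?_, ?_⟩
      · simp [Fin.sum_univ_three]
        omega
      · ext i
        fin_cases i <;> simp <;> omega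
  · rw [Nat.choose_eq_zero_of_lt (by omega), Finset.card_eq_zero, Finset.eq_empty_iff_forall_notMem]
    intro x hx
    rw [mem_expGE] at hx
    omega

lemma finrank_restrictSupport (s : Finset (Fin 3 →₀ ℕ)) :
    Module.finrank ℂ (restrictSupport ℂ (s : Set (Fin 3 →₀ ℕ))) = s.card := by
  rw [Module.finrank_eq_nat_card_basis (basisRestrictSupport ℂ (s : Set (Fin 3 →₀ ℕ)))]
  simp

lemma degree_eq_of_mem_support {d : ℕ} {F : MvPolynomial (Fin 3) ℂ} (hF : F.IsHomogeneous d)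
    {x : Fin 3 →₀ ℕ} (hx : x ∈ F.support) : x.degree = d := by
  by_contra h
  exact (mem_support_iff.1 hx) (hF.coeff_eq_zero h)

lemma homogeneousSubmodule_eq_restrictSupport (d : ℕ) :
    homogeneousSubmodule (Fin 3) ℂ d = restrictSupport ℂ (expGE d 0 0 0 : Set (Fin 3 →₀ ℕ)) := by
  ext F
  rw [mem_restrictSupport_iff, mem_homogeneousSubmodule]
  constructor
  · intro hF x hx
    have := degree_eq_of_mem_support hF hx
    rw [Finsupp.degree_eq_sum, Fin.sum_univ_three] at this
    simp [mem_expGE, this]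
  · intro h x hx
    have := h (mem_support_iff.2 hx)
    rw [Finset.mem_coe, mem_expGE] at this
    rw [Finsupp.weight_apply, Finsupp.sum_fintype _ _ (by simp)]
    simp [Fin.sum_univ_three]
    omega

lemma finrank_homogeneousSubmodule (d : ℕ) :
    Module.finrank ℂ (homogeneousSubmodule (Fin 3) ℂ d) = (d + 2).choose 2 := by
  rw [homogeneousSubmodule_eq_restrictSupport, finrank_restrictSupport, card_expGE]
  rfl

instance finiteDimensional_homogeneousSubmodule (d : ℕ) :
    FiniteDimensional ℂ (homogeneousSubmodule (Fin 3) ℂ d) :=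
  Module.finite_of_finrank_pos (by
    rw [finrank_homogeneousSubmodule]; exact Nat.choose_pos (by omega))

end Monomials

section FatPoints

/-- Setting one variable equal to `1`. -/
def dehomogenize (i : Fin 3) : MvPolynomial (Fin 3) ℂ →ₐ[ℂ] MvPolynomial (Fin 3) ℂ :=
  aeval fun j => if j = i then 1 else X j

lemma dehomogenize_monomial (i : Fin 3) (x : Fin 3 →₀ ℕ) (c : ℂ) :
    dehomogenize i (monomial x c) = monomial (x.erase i) c := by
  rw [dehomogenize, aeval_monomial, monomial_eq, algebraMap_eq]
  congr 1
  rw [Finsupp.prod_fintype _ _ (by simp), Finsupp.prod_fintype _ _ (by simp)]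
  refine Finset.prod_congr rfl fun j _ => ?_
  by_cases hj : j = i
  · simp [hj]
  · simp [hj, Finsupp.erase_ne]

lemma add_degree_erase (x : Fin 3 →₀ ℕ) (i : Fin 3) : x i + (x.erase i).degree = x.degree := by
  conv_rhs => rw [← Finsupp.single_add_erase i x, map_add, Finsupp.degree_single]

lemma coeff_dehomogenize {d : ℕ} {F : MvPolynomial (Fin 3) ℂ} (hF : F.IsHomogeneous d) (i : Fin 3)
    {x : Fin 3 →₀ ℕ} (hx : x.degree = d) :
    coeff (x.erase i) (dehomogenize i F) = coeff x F := by
  conv_lhs => rw [F.as_sum, map_sum, coeff_sum]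
  simp only [dehomogenize_monomial, coeff_monomial]
  rw [Finset.sum_eq_single x]
  · simp
  · intro y hy hyx
    rw [if_neg]
    intro h
    refine hyx ?_
    have h1 : ∀ j, j ≠ i → y j = x j := fun j hj => by
      simpa [Finsupp.erase_ne hj] using DFunLike.congr_fun h j
    have h2 : y.degree = x.degree := by rw [hx, degree_eq_of_mem_support hF hy]
    rw [← add_degree_erase y i, ← add_degree_erase x i, h, add_left_inj] at h2
    ext j
    by_cases hj : j = i
    · rw [hj, h2]
    · exact h1 j hj
  · intro h
    simp [notMem_support_iff.1 h]

lemma mem_ker_eval_single_pow {d : ℕ} {F : MvPolynomial (Fin 3) ℂ} (hF : F.IsHomogeneous d)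
    (i : Fin 3) (m : ℕ) :
    F ∈ RingHom.ker (eval (Pi.single i (1 : ℂ))) ^ m ↔ ∀ x ∈ F.support, x i + m ≤ d := by
  constructor
  · intro h x hx
    have h1 : dehomogenize i F ∈ idealOfVars (Fin 3) ℂ ^ m := by
      have h2 := Ideal.mem_map_of_mem (dehomogenize i) h
      rw [Ideal.map_pow] at h2
      refine Ideal.pow_right_mono (Ideal.map_le_iff_le_comap.2 fun G hG => ?_) m h2
      rw [Ideal.mem_comap, ← pow_one (idealOfVars _ _), mem_pow_idealOfVars_iff']
      intro y hy
      obtain rfl : y = 0 := by simpa [Finsupp.degree_eq_zero_iff] using hy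
      rw [← constantCoeff_eq, ← eval_zero]
      rw [RingHom.mem_ker] at hG
      rw [← hG, dehomogenize, ← coe_aeval_eq_eval, ← coe_aeval_eq_eval]
      change aeval 0 (aeval _ G) = aeval _ G
      rw [← AlgHom.comp_apply, comp_aeval]
      congr 2
      ext j
      by_cases hj : j = i <;> simp [hj]
    rw [mem_pow_idealOfVars_iff'] at h1
    by_contra hlt
    have h3 := add_degree_erase x i
    rw [degree_eq_of_mem_support hF hx] at h3
    have := h1 (x.erase i) (by omega)
    rw [coeff_dehomogenize hF i (degree_eq_of_mem_support hF hx)] at this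
    exact mem_support_iff.1 hx this
  · intro h
    rw [F.as_sum]
    refine Ideal.sum_mem _ fun x hx => ?_
    have h3 := add_degree_erase x i
    rw [degree_eq_of_mem_support hF hx] at h3
    have h4 := h x hx
    have h5 : monomial (x.erase i) (1 : ℂ) ∈
        RingHom.ker (eval (Pi.single i (1 : ℂ))) ^ (x.erase i).degree := by
      rw [monomial_eq, C_1, one_mul, Finsupp.prod_fintype _ _ (by simp), Finsupp.degree_eq_sum,
        ← Finset.prod_pow_eq_pow_sum]
      refine Ideal.prod_mem_prod fun j _ => ?_
      by_cases hj : j = i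
      · simp [hj]
      · exact Ideal.pow_mem_pow (by simp [RingHom.mem_ker, hj]) _
    have h6 : monomial x (coeff x F) =
        monomial (Finsupp.single i (x i)) (coeff x F) * monomial (x.erase i) 1 := by
      rw [monomial_mul, mul_one, Finsupp.single_add_erase]
    rw [h6]
    exact Ideal.mul_mem_left _ _ (Ideal.pow_le_pow_right (by omega) h5)

/-- Linear substitution of variables. -/
def linSubst (T : (Fin 3 → ℂ) ≃ₗ[ℂ] (Fin 3 → ℂ)) :
    MvPolynomial (Fin 3) ℂ →ₐ[ℂ] MvPolynomial (Fin 3) ℂ :=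
  aeval (coordForm T)

lemma eval_linSubst (T : (Fin 3 → ℂ) ≃ₗ[ℂ] (Fin 3 → ℂ)) (x : Fin 3 → ℂ)
    (F : MvPolynomial (Fin 3) ℂ) : eval x (linSubst T F) = eval (T x) F := by
  rw [linSubst, ← coe_aeval_eq_eval, ← coe_aeval_eq_eval]
  change aeval _ (aeval _ F) = aeval _ F
  rw [← AlgHom.comp_apply, comp_aeval]
  congr 2
  ext j
  simp [eval_coordForm]

lemma linSubst_symm_linSubst (T : (Fin 3 → ℂ) ≃ₗ[ℂ] (Fin 3 → ℂ)) (F : MvPolynomial (Fin 3) ℂ) :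
    linSubst T.symm (linSubst T F) = F :=
  MvPolynomial.funext fun x => by simp [eval_linSubst]

lemma linSubst_isHomogeneous (T : (Fin 3 → ℂ) ≃ₗ[ℂ] (Fin 3 → ℂ)) {d : ℕ}
    {F : MvPolynomial (Fin 3) ℂ} (hF : F.IsHomogeneous d) : (linSubst T F).IsHomogeneous d := by
  rw [linSubst]
  simpa only [one_mul] using hF.aeval _ (fun i => coordForm_isHomogeneous T i)

lemma linSubst_mem_ker_pow (T : (Fin 3 → ℂ) ≃ₗ[ℂ] (Fin 3 → ℂ)) {x : Fin 3 → ℂ} {m : ℕ}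
    {F : MvPolynomial (Fin 3) ℂ} (hF : F ∈ RingHom.ker (eval (T x)) ^ m) :
    linSubst T F ∈ RingHom.ker (eval x) ^ m := by
  have h2 := Ideal.mem_map_of_mem (linSubst T) hF
  rw [Ideal.map_pow] at h2
  refine Ideal.pow_right_mono (Ideal.map_le_iff_le_comap.2 fun G hG => ?_) m h2
  rw [RingHom.mem_ker] at hG
  rw [Ideal.mem_comap, RingHom.mem_ker, eval_linSubst, hG]

/-- Linear substitution of variables, as a linear equivalence. -/
def linSubstEquiv (T : (Fin 3 → ℂ) ≃ₗ[ℂ] (Fin 3 → ℂ)) :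
    MvPolynomial (Fin 3) ℂ ≃ₗ[ℂ] MvPolynomial (Fin 3) ℂ :=
  LinearEquiv.ofLinearMap (linSubst T).toLinearMap (linSubst T.symm).toLinearMap
    (LinearMap.ext fun F => by simpa using linSubst_symm_linSubst T.symm F)
    (LinearMap.ext fun F => linSubst_symm_linSubst T F)

lemma exists_equiv_single_of_not_collinear {p : Fin 3 → P2}
    (h : ¬ ∃ L : Set P2, IsLine L ∧ ∀ i, p i ∈ L) :
    ∃ T : (Fin 3 → ℂ) ≃ₗ[ℂ] (Fin 3 → ℂ), ∀ i, T (Pi.single i 1) = (p i).rep := by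
  have hdet : (Matrix.of fun i => (p i).rep).det ≠ 0 := by
    intro h0
    obtain ⟨a, ha, h1⟩ := Matrix.exists_mulVec_eq_zero_iff.2 h0
    refine h ⟨_, ⟨a, ha, rfl⟩, fun i => ?_⟩
    have := congrFun h1 i
    simp only [Matrix.mulVec, dotProduct, Matrix.of_apply, Pi.zero_apply] at this
    simpa [mul_comm] using this
  have hdet' : IsUnit (Matrix.of fun i => (p i).rep).transpose.det := by
    rw [Matrix.det_transpose]; exact hdet.isUnit
  refine ⟨Matrix.toLinearEquiv' _ (Matrix.invertibleOfIsUnitDet _ hdet'), fun i => ?_⟩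
  ext j
  simp [Matrix.toLinearEquiv']

lemma HFI_three_fat_points (p : Fin 3 → P2) (h : ¬ ∃ L : Set P2, IsLine L ∧ ∀ i, p i ∈ L)
    (a b c d : ℕ) :
    HFI (pointIdeal (p 0) ^ a ⊓ pointIdeal (p 1) ^ b ⊓ pointIdeal (p 2) ^ c) d =
      (expGE d (d + 1 - a) 0 0 ∪ expGE d 0 (d + 1 - b) 0 ∪ expGE d 0 0 (d + 1 - c)).card := by
  obtain ⟨T, hT⟩ := exists_equiv_single_of_not_collinear h
  have hmem : ∀ {F : MvPolynomial (Fin 3) ℂ} {i m}, F.IsHomogeneous d →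
      (F ∈ pointIdeal (p i) ^ m ↔ ∀ x ∈ (linSubst T F).support, x i + m ≤ d) := by
    intro F i m hF
    rw [← mem_ker_eval_single_pow (linSubst_isHomogeneous T hF), pointIdeal, ← hT]
    refine ⟨linSubst_mem_ker_pow T, fun h1 => ?_⟩
    rw [← linSubst_symm_linSubst T F]
    exact linSubst_mem_ker_pow T.symm (by simpa using h1)
  set U := expGE d (d + 1 - a) 0 0 ∪ expGE d 0 (d + 1 - b) 0 ∪ expGE d 0 0 (d + 1 - c) with hU
  have hUs : U ⊆ expGE d 0 0 0 := by
    intro x hx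
    simp only [hU, Finset.mem_union, mem_expGE] at hx
    rw [mem_expGE]
    omega
  have hmap : (idealCompI (pointIdeal (p 0) ^ a ⊓ pointIdeal (p 1) ^ b ⊓ pointIdeal (p 2) ^ c)
      d).map (linSubstEquiv T).toLinearMap =
      restrictSupport ℂ ((expGE d 0 0 0 \ U : Finset _) : Set (Fin 3 →₀ ℕ)) := by
    ext G
    obtain ⟨F, rfl⟩ := (linSubstEquiv T).surjective G
    have hG : F ∈ homogeneousSubmodule (Fin 3) ℂ d ↔
        linSubst T F ∈ homogeneousSubmodule (Fin 3) ℂ d := by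
      refine ⟨linSubst_isHomogeneous T, fun h => ?_⟩
      rw [← linSubst_symm_linSubst T F]
      exact linSubst_isHomogeneous T.symm h
    rw [Submodule.mem_map_equiv, LinearEquiv.symm_apply_apply]
    change F ∈ idealCompI _ _ ↔ linSubst T F ∈ _
    have hF :
        F ∈ idealCompI (pointIdeal (p 0) ^ a ⊓ pointIdeal (p 1) ^ b ⊓ pointIdeal (p 2) ^ c) d ↔
        F ∈ homogeneousSubmodule (Fin 3) ℂ d ∧ (F ∈ pointIdeal (p 0) ^ a ∧
          F ∈ pointIdeal (p 1) ^ b) ∧ F ∈ pointIdeal (p 2) ^ c := Iff.rfl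
    rw [hF, hG, homogeneousSubmodule_eq_restrictSupport, mem_restrictSupport_iff,
      mem_restrictSupport_iff]
    constructor
    · rintro ⟨h1, ⟨h2, h3⟩, h4⟩ x hx
      have hFh := hG.2 (by rwa [homogeneousSubmodule_eq_restrictSupport, mem_restrictSupport_iff])
      have h2 := (hmem hFh).1 h2 x hx
      have h3 := (hmem hFh).1 h3 x hx
      have h4 := (hmem hFh).1 h4 x hx
      have h1 := h1 hx
      simp only [Finset.mem_coe, hU, Finset.mem_union, mem_expGE, Finset.mem_sdiff] at h1 ⊢
      omega
    · intro h1
      have h0 := h1.trans (Finset.coe_subset.2 Finset.sdiff_subset)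
      have hFh := hG.2 (by rwa [homogeneousSubmodule_eq_restrictSupport, mem_restrictSupport_iff])
      refine ⟨h0, ⟨(hmem hFh).2 ?_, (hmem hFh).2 ?_⟩, (hmem hFh).2 ?_⟩ <;>
      · intro x hx
        have h1 := h1 hx
        simp only [Finset.mem_coe, hU, Finset.mem_union, mem_expGE, Finset.mem_sdiff] at h1
        omega
  rw [HFI, ← LinearEquiv.finrank_map_eq (linSubstEquiv T) (idealCompI _ _)]
  rw [hmap, homogeneousSubmodule_eq_restrictSupport, finrank_restrictSupport,
    finrank_restrictSupport, Finset.card_sdiff_of_subset hUs,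
    Nat.cast_sub (Finset.card_le_card hUs)]
  ring

end FatPoints

section HilbertFunction

open Matrix

variable (T : (Fin 3 → ℂ) ≃ₗ[ℂ] (Fin 3 → ℂ))

lemma forall_eval_skewToForm_eq_zero_iff {d : ℕ} {M : Matrix (Fin (d + 2)) (Fin (d + 2)) ℂ}
    (hM : Mᵀ = -M) {ι : Type*} {u w : ι → ℂ} (h : ∀ i j, i ≠ j → u i * w j ≠ u j * w i) :
    (∀ i j, i ≠ j → eval (T.symm (symPoint (u i) (w i) (u j) (w j))) (skewToForm T d M) = 0) ↔
      ∀ i j, powVec (d + 2) (u i) (w i) ⬝ᵥ M *ᵥ powVec (d + 2) (u j) (w j) = 0 := by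
  constructor
  · intro h1 i j
    by_cases hij : i = j
    · rw [hij, ← self_eq_neg, ← skew_dotProduct hM]
    · rw [← neg_eq_zero, ← eval_skewToForm T hM, h1 i j hij, zero_mul]
  · intro h1 i j hij
    have h2 := eval_skewToForm T hM (u i) (w i) (u j) (w j)
    rw [h1, neg_zero] at h2
    exact (mul_eq_zero.1 h2).resolve_right (sub_ne_zero.2 (h i j hij))

lemma skewToForm_injOn {d : ℕ} {M : Matrix (Fin (d + 2)) (Fin (d + 2)) ℂ} (hM : Mᵀ = -M)
    (h : skewToForm T d M = 0) : M = 0 := by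
  have hi : ∀ i j : Fin (d + 2), i ≠ j → ((i : ℕ) : ℂ) * 1 ≠ ((j : ℕ) : ℂ) * 1 := by
    intro i j hij
    simpa [Fin.val_inj] using hij
  have h1 := (forall_eval_skewToForm_eq_zero_iff T hM
    (u := fun i : Fin (d + 2) => ((i : ℕ) : ℂ)) (w := fun _ => 1) hi).1 (by simp [h])
  have h2 := (skew_orthogonal_iff _ hM).2 h1
  rw [span_powVec_eq_top (by simp) hi] at h2
  have h3 : (⟨M, hM, fun _ => trivial⟩ : skewIn (⊤ : Submodule ℂ (Fin (d + 2) → ℂ))) ∈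
      (skewPairing : LinearMap.BilinForm ℂ (skewIn (⊤ : Submodule ℂ (Fin (d + 2) → ℂ)))).ker :=
    LinearMap.mem_ker.2 (LinearMap.ext fun N => h2 N.1 N.2)
  rw [skewPairing_ker, Submodule.mem_bot] at h3
  exact congrArg Subtype.val h3

lemma finrank_map_skewToForm {d : ℕ} {K : Submodule ℂ (Matrix (Fin (d + 2)) (Fin (d + 2)) ℂ)}
    (hK : K ≤ skewIn ⊤) :
    Module.finrank ℂ (K.map (skewToForm T d)) = Module.finrank ℂ K := by
  rw [← LinearMap.range_domRestrict]
  refine LinearMap.finrank_range_of_inj ((injective_iff_map_eq_zero _).2 fun M hM => ?_)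
  exact Subtype.ext (skewToForm_injOn T (hK M.2).1 hM)

lemma map_skewToForm_top (d : ℕ) :
    (skewIn ⊤).map (skewToForm T d) = homogeneousSubmodule (Fin 3) ℂ d := by
  refine Submodule.eq_of_le_of_finrank_eq
    (Submodule.map_le_iff_le_comap.2 fun M _ => skewToForm_isHomogeneous T M) ?_
  rw [finrank_map_skewToForm T le_rfl, finrank_skewIn_top, finrank_homogeneousSubmodule]

lemma HF_eq_finrank_skewIn {ι₁ ι₂ ι₃ : Type*} [Fintype ι₁] [Fintype ι₂] [Fintype ι₃]
    {u₁ w₁ : ι₁ → ℂ} {u₂ w₂ : ι₂ → ℂ} {u₃ w₃ : ι₃ → ℂ}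
    (h₁ : ∀ i j, i ≠ j → u₁ i * w₁ j ≠ u₁ j * w₁ i)
    (h₂ : ∀ i j, i ≠ j → u₂ i * w₂ j ≠ u₂ j * w₂ i)
    (h₃ : ∀ i j, i ≠ j → u₃ i * w₃ j ≠ u₃ j * w₃ i) (W : Set P2) (d : ℕ)
    (hW : ∀ F : MvPolynomial (Fin 3) ℂ, F.IsHomogeneous d → ((∀ p ∈ W, eval p.rep F = 0) ↔
      (∀ i j, i ≠ j → eval (T.symm (symPoint (u₁ i) (w₁ i) (u₁ j) (w₁ j))) F = 0) ∧
      (∀ i j, i ≠ j → eval (T.symm (symPoint (u₂ i) (w₂ i) (u₂ j) (w₂ j))) F = 0) ∧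
      (∀ i j, i ≠ j → eval (T.symm (symPoint (u₃ i) (w₃ i) (u₃ j) (w₃ j))) F = 0))) :
    HF W d = Module.finrank ℂ ↥(
      skewIn (Submodule.span ℂ (Set.range fun i => powVec (d + 2) (u₁ i) (w₁ i))) ⊔
      skewIn (Submodule.span ℂ (Set.range fun i => powVec (d + 2) (u₂ i) (w₂ i))) ⊔
      skewIn (Submodule.span ℂ (Set.range fun i => powVec (d + 2) (u₃ i) (w₃ i)))) := by
  set K : Submodule ℂ (Matrix (Fin (d + 2)) (Fin (d + 2)) ℂ) :=
    skewIn ⊤ ⊓ (vanishingSubmodule W).comap (skewToForm T d) with hK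
  have hmap : K.map (skewToForm T d) = idealComp W d := by
    rw [hK, ← Submodule.map_inf_eq_map_inf_comap, map_skewToForm_top, idealComp]
  have hmem : ∀ M, M ∈ K ↔ Mᵀ = -M ∧
      (∀ i j, powVec (d + 2) (u₁ i) (w₁ i) ⬝ᵥ M *ᵥ powVec (d + 2) (u₁ j) (w₁ j) = 0) ∧
      (∀ i j, powVec (d + 2) (u₂ i) (w₂ i) ⬝ᵥ M *ᵥ powVec (d + 2) (u₂ j) (w₂ j) = 0) ∧
      ∀ i j, powVec (d + 2) (u₃ i) (w₃ i) ⬝ᵥ M *ᵥ powVec (d + 2) (u₃ j) (w₃ j) = 0 := by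
    intro M
    have h0 : M ∈ K ↔ Mᵀ = -M ∧ ∀ p ∈ W, eval p.rep (skewToForm T d M) = 0 :=
      ⟨fun h => ⟨h.1.1, h.2⟩, fun h => ⟨⟨h.1, fun _ => trivial⟩, h.2⟩⟩
    rw [h0]
    refine and_congr_right fun hM => ?_
    rw [hW _ (skewToForm_isHomogeneous T M), forall_eval_skewToForm_eq_zero_iff T hM h₁,
      forall_eval_skewToForm_eq_zero_iff T hM h₂, forall_eval_skewToForm_eq_zero_iff T hM h₃]
  have h := finrank_add_finrank_skew_vanishing _ _ _ hmem
  rw [Fintype.card_fin] at h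
  rw [HF, ← hmap, finrank_map_skewToForm T inf_le_left, finrank_homogeneousSubmodule, ← h]
  push_cast
  ring

end HilbertFunction

section Conics

lemma eval_smul_of_isHomogeneous {d : ℕ} {F : MvPolynomial (Fin 3) ℂ} (hF : F.IsHomogeneous d)
    (c : ℂ) (x : Fin 3 → ℂ) : eval (c • x) F = c ^ d * eval x F := by
  rw [eval_eq', eval_eq', Finset.mul_sum]
  refine Finset.sum_congr rfl fun y hy => ?_
  simp only [Pi.smul_apply, smul_eq_mul, mul_pow, Finset.prod_mul_distrib]
  rw [Finset.prod_pow_eq_pow_sum, ← Finsupp.degree_eq_sum, degree_eq_of_mem_support hF hy]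
  ring

lemma exists_linearMap_eval_eq {F : MvPolynomial (Fin 3) ℂ} (hF : F.IsHomogeneous 1) :
    ∃ f : (Fin 3 → ℂ) →ₗ[ℂ] ℂ, ∀ x, eval x F = f x := by
  rw [← mem_homogeneousSubmodule, homogeneousSubmodule_one_eq_span_X] at hF
  induction hF using Submodule.span_induction with
  | mem F h => obtain ⟨i, rfl⟩ := h; exact ⟨LinearMap.proj i, by simp⟩
  | zero => exact ⟨0, by simp⟩
  | add F G _ _ hF hG =>
    obtain ⟨f, hf⟩ := hF
    obtain ⟨g, hg⟩ := hG
    exact ⟨f + g, by simp [hf, hg]⟩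
  | smul c F _ hF =>
    obtain ⟨f, hf⟩ := hF
    exact ⟨c • f, by simp [hf]⟩

lemma exists_quadraticForm_eval_eq {q : MvPolynomial (Fin 3) ℂ} (hq : q.IsHomogeneous 2) :
    ∃ Q : QuadraticForm ℂ (Fin 3 → ℂ), ∀ x, eval x q = Q x := by
  rw [← mem_homogeneousSubmodule, ← homogeneousSubmodule_one_pow, pow_two] at hq
  induction hq using Submodule.mul_induction_on' with
  | mem_mul_mem F hF G hG =>
    obtain ⟨f, hf⟩ := exists_linearMap_eval_eq hF
    obtain ⟨g, hg⟩ := exists_linearMap_eval_eq hG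
    exact ⟨QuadraticMap.linMulLin f g, by simp [hf, hg]⟩
  | add F _ G _ hF hG =>
    obtain ⟨f, hf⟩ := hF
    obtain ⟨g, hg⟩ := hG
    exact ⟨f + g, by simp [hf, hg]⟩

lemma not_irreducible_add_sq {q G H : MvPolynomial (Fin 3) ℂ} (hG : G.IsHomogeneous 1)
    (hH : H.IsHomogeneous 1) (a b : ℂ) (hq : q = C a * G ^ 2 + C b * H ^ 2) :
    ¬ Irreducible q := by
  intro hirr
  obtain ⟨α, hα⟩ := IsAlgClosed.exists_pow_nat_eq a (n := 2) (by norm_num)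
  obtain ⟨β, hβ⟩ := IsAlgClosed.exists_pow_nat_eq (-b) (n := 2) (by norm_num)
  have hfac : q = (C α * G + C β * H) * (C α * G - C β * H) := by
    rw [hq, ← hα, show b = -β ^ 2 by rw [hβ, neg_neg]]
    simp only [map_pow, map_neg]
    ring
  have h0 : ∀ F : MvPolynomial (Fin 3) ℂ, F.IsHomogeneous 1 → ¬ IsUnit F := by
    intro F hF hu
    have := hu.map (eval (0 : Fin 3 → ℂ))
    rw [← zero_smul ℂ (0 : Fin 3 → ℂ), eval_smul_of_isHomogeneous hF] at this
    simp at this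
  rcases hirr.isUnit_or_isUnit hfac with h | h
  · exact h0 _ ((hG.C_mul α).add (hH.C_mul β)) h
  · exact h0 _ ((hG.C_mul α).sub (hH.C_mul β)) h

/-- Every irreducible conic is the curve `y² = 4 x z` in suitable coordinates. -/
lemma exists_conic_normal_form {q : MvPolynomial (Fin 3) ℂ} (hq : q.IsHomogeneous 2)
    (hirr : Irreducible q) : ∃ T : (Fin 3 → ℂ) ≃ₗ[ℂ] (Fin 3 → ℂ),
      ∀ x, eval x q = T x 1 ^ 2 - 4 * T x 0 * T x 2 := by
  obtain ⟨Q, hQ⟩ := exists_quadraticForm_eval_eq hq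
  have hw := QuadraticForm.equivalent_weightedSumSquares Q
  rw [Module.finrank_fin_fun] at hw
  obtain ⟨w, ⟨e⟩⟩ := hw
  have hqe : ∀ x, eval x q = w 0 * e x 0 ^ 2 + w 1 * e x 1 ^ 2 + w 2 * e x 2 ^ 2 := by
    intro x
    rw [hQ, ← e.map_app, QuadraticMap.weightedSumSquares_apply, Fin.sum_univ_three]
    simp [pow_two]
  have hpoly : q = C (w 0) * coordForm e.toLinearEquiv 0 ^ 2 +
      C (w 1) * coordForm e.toLinearEquiv 1 ^ 2 + C (w 2) * coordForm e.toLinearEquiv 2 ^ 2 :=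
    MvPolynomial.funext fun x => by
      rw [hqe]
      simp [eval_coordForm]
  have hc := coordForm_isHomogeneous e.toLinearEquiv
  have hw0 : ∀ i, w i ≠ 0 := by
    intro i hi
    fin_cases i
    · exact not_irreducible_add_sq (hc 1) (hc 2) (w 1) (w 2)
        (by rw [hpoly, show w 0 = 0 from hi]; simp) hirr
    · exact not_irreducible_add_sq (hc 0) (hc 2) (w 0) (w 2)
        (by rw [hpoly, show w 1 = 0 from hi]; simp) hirr
    · exact not_irreducible_add_sq (hc 0) (hc 1) (w 0) (w 1)
        (by rw [hpoly, show w 2 = 0 from hi]; simp) hirr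
  choose ω hω using fun i => IsAlgClosed.exists_pow_nat_eq (w i) (n := 2) (by norm_num)
  have hω0 : ∀ i, ω i ≠ 0 := fun i h => hw0 i (by rw [← hω, h]; simp)
  set M : Matrix (Fin 3) (Fin 3) ℂ := !![ω 0, 0, Complex.I * ω 2; 0, ω 1, 0;
    -ω 0 / 4, 0, Complex.I * ω 2 / 4] with hM
  have hdet : IsUnit M.det := by
    have : M.det = Complex.I * ω 0 * ω 1 * ω 2 / 2 := by
      rw [hM, Matrix.det_fin_three]
      simp
      ring
    rw [this]
    simp [hω0]
  refine ⟨e.toLinearEquiv.trans (Matrix.toLinearEquiv' M (M.invertibleOfIsUnitDet hdet)),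
    fun x => ?_⟩
  have happ : ∀ y, Matrix.toLinearEquiv' M (M.invertibleOfIsUnitDet hdet) y = M.mulVec y :=
    fun _ => rfl
  simp only [LinearEquiv.trans_apply, happ]
  rw [hqe, ← hω, ← hω, ← hω]
  simp [hM, Matrix.mulVec, dotProduct, Fin.sum_univ_three]
  linear_combination (ω 2 ^ 2 * e x 2 ^ 2) * Complex.I_sq

end Conics

section Tangents

variable {T : (Fin 3 → ℂ) ≃ₗ[ℂ] (Fin 3 → ℂ)}

/-- The line tangent to `y² = 4 x z` at `[u² : 2 u w : w²]`, in the coordinates given by `T`. -/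
def tangentForm (T : (Fin 3 → ℂ) ≃ₗ[ℂ] (Fin 3 → ℂ)) (u w : ℂ) (x : Fin 3 → ℂ) : ℂ :=
  w ^ 2 * T x 0 - u * w * T x 1 + u ^ 2 * T x 2

lemma exists_eq_tangentForm {γ L : Set P2} 
    (hγ : γ = {p | T p.rep 1 ^ 2 - 4 * T p.rep 0 * T p.rep 2 = 0})
    (hL : IsLine L) (h : IsTangent L γ) :
    ∃ u w : ℂ, (u ≠ 0 ∨ w ≠ 0) ∧ ∀ p, p ∈ L ↔ tangentForm T u w p.rep = 0 := by
  obtain ⟨a, ha, rfl⟩ := hL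
  set b : Fin 3 → ℂ := fun k => ∑ i, a i * T.symm (Pi.single k 1) i with hb
  have hab : ∀ x, ∑ i, a i * x i = b 0 * T x 0 + b 1 * T x 1 + b 2 * T x 2 := by
    intro x
    obtain ⟨y, rfl⟩ := T.symm.surjective x
    conv_lhs => rw [pi_eq_sum_univ' y]
    simp [Fin.sum_univ_three, hb]
    ring
  have hb0 : b ≠ 0 := by
    intro h0
    refine ha (funext fun i => ?_)
    simpa [h0, Pi.single_apply] using hab (Pi.single i 1)
  have hmem : ∀ p : P2, p ∈ {p : P2 | ∑ i, a i * p.rep i = 0} ↔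
      b 0 * T p.rep 0 + b 1 * T p.rep 1 + b 2 * T p.rep 2 = 0 := fun p => by
    rw [Set.mem_ofPred_eq, hab]
  have hsq : b 1 ^ 2 = b 0 * b 2 := by
    by_contra hne
    obtain ⟨U, V, U', V', h1, h2, hdet⟩ : ∃ U V U' V' : ℂ,
        b 0 * U ^ 2 + 2 * b 1 * U * V + b 2 * V ^ 2 = 0 ∧
        b 0 * U' ^ 2 + 2 * b 1 * U' * V' + b 2 * V' ^ 2 = 0 ∧ U * V' - U' * V ≠ 0 := by
      by_cases h0 : b 0 = 0
      · have h1 : b 1 ≠ 0 := fun h1 => hne (by simp [h0, h1])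
        exact ⟨1, 0, -b 2, 2 * b 1, by simp [h0], by rw [h0]; ring, by simpa using h1⟩
      · obtain ⟨δ, hδ⟩ := IsAlgClosed.exists_pow_nat_eq (b 1 ^ 2 - b 0 * b 2) (n := 2) (by norm_num)
        have hδ0 : δ ≠ 0 := by
          rintro rfl
          exact hne (by linear_combination -hδ)
        refine ⟨-b 1 + δ, b 0, -b 1 - δ, b 0, by linear_combination b 0 * hδ,
          by linear_combination b 0 * hδ, ?_⟩
        rw [show (-b 1 + δ) * b 0 - (-b 1 - δ) * b 0 = 2 * δ * b 0 by ring]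
        simp [hδ0, h0]
    obtain ⟨p, hp⟩ := h
    have hpt : ∀ U V : ℂ, b 0 * U ^ 2 + 2 * b 1 * U * V + b 2 * V ^ 2 = 0 → (U ≠ 0 ∨ V ≠ 0) →
        ∃ c : ℂ, ![U ^ 2, 2 * U * V, V ^ 2] = c • T p.rep := by
      intro U V hUV h0
      have hv : T.symm ![U ^ 2, 2 * U * V, V ^ 2] ≠ 0 := by
        rw [Ne, LinearEquiv.map_eq_zero_iff]
        intro hz
        have hz0 := congrFun hz 0
        have hz2 := congrFun hz 2
        simp at hz0 hz2
        rcases h0 with h | h <;> contradiction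
      obtain ⟨c, hc⟩ := Projectivization.exists_smul_eq_mk_rep ℂ _ hv
      have hTc : T (Projectivization.mk ℂ _ hv).rep = (c : ℂ) • ![U ^ 2, 2 * U * V, V ^ 2] := by
        rw [← hc, Units.smul_def, map_smul, LinearEquiv.apply_symm_apply]
      have hmk : Projectivization.mk ℂ _ hv ∈ {p : P2 | ∑ i, a i * p.rep i = 0} ∩ γ := by
        refine ⟨(hmem _).2 ?_, ?_⟩
        · rw [hTc]
          simp
          linear_combination (c : ℂ) * hUV
        · rw [hγ, Set.mem_ofPred_eq, hTc]
          simp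
          ring
      rw [hp, Set.mem_singleton_iff] at hmk
      rw [hmk] at hTc
      exact ⟨(c : ℂ)⁻¹, by rw [hTc, smul_smul, inv_mul_cancel₀ c.ne_zero, one_smul]⟩
    obtain ⟨c, hc⟩ := hpt U V h1 (by by_contra! h; exact hdet (by simp [h.1, h.2]))
    obtain ⟨c', hc'⟩ := hpt U' V' h2 (by by_contra! h; exact hdet (by simp [h.1, h.2]))
    have e0 := congrFun hc 0
    have e1 := congrFun hc 1
    have e2 := congrFun hc 2
    have e0' := congrFun hc' 0
    have e1' := congrFun hc' 1
    have e2' := congrFun hc' 2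
    simp at e0 e1 e2 e0' e1' e2'
    have e3 : T p.rep 1 ^ 2 - 4 * T p.rep 0 * T p.rep 2 = 0 := by
      have : p ∈ {p : P2 | ∑ i, a i * p.rep i = 0} ∩ γ := by rw [hp]; rfl
      rw [hγ] at this
      exact this.2
    refine hdet (pow_eq_zero_iff (n := 2) (by norm_num) |>.1 ?_)
    have : (U * V' - U' * V) ^ 2 = U ^ 2 * V' ^ 2 + U' ^ 2 * V ^ 2 -
      (2 * U * V) * (2 * U' * V') / 2 := by ring
    rw [this, e0, e1, e2, e0', e1', e2']
    linear_combination (-c * c' / 2) * e3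
  obtain ⟨w, hw⟩ := IsAlgClosed.exists_pow_nat_eq (b 0) (n := 2) (by norm_num)
  obtain ⟨u, hu, huw⟩ : ∃ u, u ^ 2 = b 2 ∧ u * w = -b 1 := by
    by_cases h0 : w = 0
    · obtain ⟨u, hu⟩ := IsAlgClosed.exists_pow_nat_eq (b 2) (n := 2) (by norm_num)
      refine ⟨u, hu, ?_⟩
      rw [← hw, h0] at hsq
      simp at hsq
      simp [h0, hsq]
    · refine ⟨-b 1 / w, ?_, by field_simp⟩
      rw [div_pow, div_eq_iff (pow_ne_zero 2 h0), hw]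
      linear_combination hsq
  refine ⟨u, w, ?_, fun p => ?_⟩
  · by_contra! h0
    refine hb0 (funext fun i => ?_)
    fin_cases i
    · simp [← hw, h0]
    · simpa [h0] using huw.symm
    · simp [← hu, h0]
  · rw [hmem, tangentForm, hw, hu, huw]
    ring_nf

lemma mul_ne_mul_of_ne {L L' : Set P2} {u w u' w' : ℂ}
    (h0 : u ≠ 0 ∨ w ≠ 0) (h0' : u' ≠ 0 ∨ w' ≠ 0)
    (h : ∀ p, p ∈ L ↔ tangentForm T u w p.rep = 0)
    (h' : ∀ p, p ∈ L' ↔ tangentForm T u' w' p.rep = 0) (hne : L ≠ L') :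
    u * w' ≠ u' * w := by
  intro heq
  refine hne (Set.ext fun p => ?_)
  rw [h, h']
  have hw : w ^ 2 * tangentForm T u' w' p.rep = w' ^ 2 * tangentForm T u w p.rep := by
    simp only [tangentForm]
    linear_combination (-(w * w') * T p.rep 1 * -1 - (u' * w + u * w') * T p.rep 2) * heq
  have hu : u ^ 2 * tangentForm T u' w' p.rep = u' ^ 2 * tangentForm T u w p.rep := by
    simp only [tangentForm]
    linear_combination ((u * w' + u' * w) * T p.rep 0 - u * u' * T p.rep 1) * heq
  constructor
  · intro hz
    rw [hz, mul_zero] at hw hu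
    rcases h0 with h | h
    · simpa [h] using hu
    · simpa [h] using hw
  · intro hz
    rw [hz, mul_zero, zero_eq_mul] at hw hu
    rcases h0' with h | h
    · simpa [h] using hu
    · simpa [h] using hw

lemma symPoint_ne_zero {u w u' w' : ℂ} (h : u * w' ≠ u' * w) : symPoint u w u' w' ≠ 0 := by
  intro hz
  have e0 := congrFun hz 0
  have e1 := congrFun hz 1
  have e2 := congrFun hz 2
  simp [symPoint] at e0 e1 e2
  have : (u * w' - u' * w) ^ 2 = 0 := by
    rw [show (u * w' - u' * w) ^ 2 = (u * w' + u' * w) ^ 2 - 4 * (u * u') * (w * w') by ring, e1]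
    rcases e0 with h | h <;> simp [h]
  exact h (sub_eq_zero.1 (pow_eq_zero_iff two_ne_zero |>.1 this))

lemma tangentForm_symPoint (u w u' w' : ℂ) (c : ℂ) :
    tangentForm T u w (c • T.symm (symPoint u w u' w')) = 0 ∧
      tangentForm T u' w' (c • T.symm (symPoint u w u' w')) = 0 := by
  constructor <;>
  · simp [tangentForm, symPoint]
    ring

lemma exists_eq_smul_symPoint {u w u' w' : ℂ} (h : u * w' ≠ u' * w) {x : Fin 3 → ℂ}
    (hx : tangentForm T u w x = 0) (hx' : tangentForm T u' w' x = 0) :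
    ∃ c : ℂ, x = c • T.symm (symPoint u w u' w') := by
  have hD : u * w' - u' * w ≠ 0 := sub_ne_zero.2 h
  simp only [tangentForm] at hx hx'
  have h12 : w * w' * T x 1 = (u * w' + u' * w) * T x 2 := mul_left_cancel₀ hD (by
    linear_combination -w' ^ 2 * hx + w ^ 2 * hx')
  have h01 : u * u' * T x 1 = (u * w' + u' * w) * T x 0 := mul_left_cancel₀ hD (by
    linear_combination u' ^ 2 * hx - u ^ 2 * hx')
  have h02 : w * w' * T x 0 = u * u' * T x 2 := mul_left_cancel₀ hD (by
    linear_combination -u' * w' * hx + u * w * hx')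
  suffices h : ∃ c : ℂ, T x = c • symPoint u w u' w' by
    obtain ⟨c, hc⟩ := h
    exact ⟨c, by rw [← map_smul, ← hc, LinearEquiv.symm_apply_apply]⟩
  obtain ⟨i, hi⟩ := Function.ne_iff.1 (symPoint_ne_zero h)
  refine ⟨T x i / symPoint u w u' w' i, funext fun j => ?_⟩
  rw [Pi.smul_apply, smul_eq_mul, div_mul_eq_mul_div, eq_div_iff hi]
  fin_cases i <;> fin_cases j <;> simp [symPoint]
  all_goals first
    | ring1
    | linear_combination h01
    | linear_combination -h01
    | linear_combination h02
    | linear_combination -h02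
    | linear_combination h12
    | linear_combination -h12

lemma forall_starConfig_eval_eq_zero_iff {r : ℕ} {L : Fin r → Set P2} {u w : Fin r → ℂ}
    (hL : ∀ i p, p ∈ L i ↔ tangentForm T (u i) (w i) p.rep = 0)
    (h : ∀ i j, i ≠ j → u i * w j ≠ u j * w i) {d : ℕ} {F : MvPolynomial (Fin 3) ℂ}
    (hF : F.IsHomogeneous d) : (∀ p ∈ starConfig L, eval p.rep F = 0) ↔
      ∀ i j, i ≠ j → eval (T.symm (symPoint (u i) (w i) (u j) (w j))) F = 0 := by
  constructor
  · intro hv i j hij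
    have h0 : T.symm (symPoint (u i) (w i) (u j) (w j)) ≠ 0 := by
      rw [Ne, LinearEquiv.map_eq_zero_iff]
      exact symPoint_ne_zero (h i j hij)
    obtain ⟨c, hc⟩ := Projectivization.exists_smul_eq_mk_rep ℂ _ h0
    have := tangentForm_symPoint (T := T) (u i) (w i) (u j) (w j) c
    have hz := hv (Projectivization.mk ℂ _ h0) ⟨i, j, hij, (hL _ _).2 (by rw [← hc]; exact this.1),
      (hL _ _).2 (by rw [← hc]; exact this.2)⟩
    rw [← hc, Units.smul_def, eval_smul_of_isHomogeneous hF] at hz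
    simpa using hz
  · rintro hv p ⟨i, j, hij, hi, hj⟩
    obtain ⟨c, hc⟩ := exists_eq_smul_symPoint (h i j hij) ((hL _ _).1 hi) ((hL _ _).1 hj)
    rw [hc, eval_smul_of_isHomogeneous hF, hv i j hij, mul_zero]

end Tangents

section ThreeStars

lemma card_expGE_union {r s t d : ℕ} (hr : r ≤ d + 1) (hs : s ≤ d + 1) (ht : t ≤ d + 1)
    (hr1 : 1 ≤ r) (hs1 : 1 ≤ s) (ht1 : 1 ≤ t) (hrs : r + s ≤ d + 2) :
    (expGE d (d + 1 - (t - 1)) 0 0 ∪ expGE d 0 (d + 1 - (r - 1)) 0 ∪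
      expGE d 0 0 (d + 1 - (s - 1))).card + ((t + r - (d + 2)).choose 2 +
        (t + s - (d + 2)).choose 2) = r.choose 2 + s.choose 2 + t.choose 2 := by
  set A := expGE d (d + 1 - (t - 1)) 0 0 with hA
  set B := expGE d 0 (d + 1 - (r - 1)) 0 with hB
  set C := expGE d 0 0 (d + 1 - (s - 1)) with hC
  have hAB : A ∩ B = expGE d (d + 1 - (t - 1)) (d + 1 - (r - 1)) 0 := by
    ext x; simp only [hA, hB, Finset.mem_inter, mem_expGE]; omega
  have hABC : (A ∪ B) ∩ C = expGE d (d + 1 - (t - 1)) 0 (d + 1 - (s - 1)) := by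
    ext x; simp only [hA, hB, hC, Finset.mem_inter, Finset.mem_union, mem_expGE]; omega
  have h1 := Finset.card_union_add_card_inter A B
  have h2 := Finset.card_union_add_card_inter (A ∪ B) C
  rw [hAB] at h1
  rw [hABC] at h2
  simp only [hA, hB, hC, card_expGE] at h1 h2 ⊢
  rw [show d + 2 - (d + 1 - (t - 1) + 0 + 0) = t by omega,
    show d + 2 - (0 + (d + 1 - (r - 1)) + 0) = r by omega,
    show d + 2 - (d + 1 - (t - 1) + (d + 1 - (r - 1)) + 0) = t + r - (d + 2) by omega] at h1
  rw [show d + 2 - (0 + 0 + (d + 1 - (s - 1))) = s by omega,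
    show d + 2 - (d + 1 - (t - 1) + 0 + (d + 1 - (s - 1))) = t + s - (d + 2) by omega] at h2
  omega

lemma card_expGE_union_of_le {t d : ℕ} (ht : d + 2 ≤ t) (b c : ℕ) :
    (expGE d (d + 1 - (t - 1)) 0 0 ∪ expGE d 0 b 0 ∪ expGE d 0 0 c).card = (d + 2).choose 2 := by
  have h : expGE d (d + 1 - (t - 1)) 0 0 ∪ expGE d 0 b 0 ∪ expGE d 0 0 c = expGE d 0 0 0 := by
    ext x; simp only [Finset.mem_union, mem_expGE]; omega
  rw [h, card_expGE]
  rfl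

variable {r s t : ℕ} {u₁ w₁ : Fin r → ℂ} {u₂ w₂ : Fin s → ℂ} {u₃ w₃ : Fin t → ℂ}

lemma finrank_skewIn_powVec (n : ℕ) (h01 : ∀ i, u₁ i ≠ 0 ∨ w₁ i ≠ 0)
    (h02 : ∀ i, u₂ i ≠ 0 ∨ w₂ i ≠ 0) (h03 : ∀ i, u₃ i ≠ 0 ∨ w₃ i ≠ 0)
    (h₁ : ∀ i j, i ≠ j → u₁ i * w₁ j ≠ u₁ j * w₁ i)
    (h₂ : ∀ i j, i ≠ j → u₂ i * w₂ j ≠ u₂ j * w₂ i)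
    (h₃ : ∀ i j, i ≠ j → u₃ i * w₃ j ≠ u₃ j * w₃ i)
    (h₁₂ : ∀ i j, u₁ i * w₂ j ≠ u₂ j * w₁ i) (h₁₃ : ∀ i j, u₁ i * w₃ j ≠ u₃ j * w₁ i)
    (h₂₃ : ∀ i j, u₂ i * w₃ j ≠ u₃ j * w₂ i) (hr : r ≤ n) (hs : s ≤ n) (ht : t ≤ n)
    (hrs : r + s ≤ n) :
    Module.finrank ℂ ↥(
      skewIn (Submodule.span ℂ (Set.range fun i => powVec n (u₁ i) (w₁ i))) ⊔
      skewIn (Submodule.span ℂ (Set.range fun i => powVec n (u₂ i) (w₂ i))) ⊔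
      skewIn (Submodule.span ℂ (Set.range fun i => powVec n (u₃ i) (w₃ i)))) +
      ((t + r - n).choose 2 + (t + s - n).choose 2) = r.choose 2 + s.choose 2 + t.choose 2 := by
  have f₁ := finrank_span_powVec n h01 h₁
  have f₂ := finrank_span_powVec n h02 h₂
  have f₃ := finrank_span_powVec n h03 h₃
  have f₁₂ := finrank_span_powVec_inf n h01 h₁ h02 h₂ h₁₂
  have f₁₃ := finrank_span_powVec_inf n h01 h₁ h03 h₃ h₁₃
  have f₂₃ := finrank_span_powVec_inf n h02 h₂ h03 h₃ h₂₃
  simp only [Fintype.card_fin] at f₁ f₂ f₃ f₁₂ f₁₃ f₂₃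
  have hdisj := disjoint_iff.2 (Submodule.finrank_eq_zero.1 (show Module.finrank ℂ
    ↥(Submodule.span ℂ (Set.range fun i => powVec n (u₁ i) (w₁ i)) ⊓
      Submodule.span ℂ (Set.range fun i => powVec n (u₂ i) (w₂ i))) = 0 by omega))
  have h := finrank_skewIn_sup hdisj
    (Submodule.span ℂ (Set.range fun i => powVec n (u₃ i) (w₃ i)))
  rwa [f₁, f₂, f₃, min_eq_left hr, min_eq_left hs, min_eq_left ht,
    show Module.finrank ℂ ↥(Submodule.span ℂ (Set.range fun i => powVec n (u₁ i) (w₁ i)) ⊓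
      Submodule.span ℂ (Set.range fun i => powVec n (u₃ i) (w₃ i))) = t + r - n by omega,
    show Module.finrank ℂ ↥(Submodule.span ℂ (Set.range fun i => powVec n (u₂ i) (w₂ i)) ⊓
      Submodule.span ℂ (Set.range fun i => powVec n (u₃ i) (w₃ i))) = t + s - n by omega] at h

lemma finrank_skewIn_powVec_of_le {n : ℕ} (hn : n ≤ t) (A B : Submodule ℂ (Fin n → ℂ))
    (h₃ : ∀ i j, i ≠ j → u₃ i * w₃ j ≠ u₃ j * w₃ i) :
    Module.finrank ℂ ↥(skewIn A ⊔ skewIn B ⊔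
      skewIn (Submodule.span ℂ (Set.range fun i => powVec n (u₃ i) (w₃ i)))) = n.choose 2 := by
  rw [span_powVec_eq_top (by simpa using hn) h₃,
    sup_eq_right.2 (sup_le (skewIn_mono le_top) (skewIn_mono le_top)), finrank_skewIn_top]

lemma HF_three_contact_stars {γ : Set P2} (hγ : IsIrredConic γ) (hr : 1 ≤ r) (hs : 1 ≤ s)
    (hrt : r ≤ t) (hst : s ≤ t) (hrs : r + s ≤ t + 1)
    {ℓ : Fin r → Set P2} {m : Fin s → Set P2} {nn : Fin t → Set P2}
    (hℓline : ∀ i, IsLine (ℓ i)) (hmline : ∀ j, IsLine (m j)) (hnline : ∀ k, IsLine (nn k))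
    (hℓtan : ∀ i, IsTangent (ℓ i) γ) (hmtan : ∀ j, IsTangent (m j) γ)
    (hntan : ∀ k, IsTangent (nn k) γ)
    (hℓinj : Function.Injective ℓ) (hminj : Function.Injective m)
    (hninj : Function.Injective nn)
    (hℓm : ∀ i j, ℓ i ≠ m j) (hℓn : ∀ i k, ℓ i ≠ nn k) (hmn : ∀ j k, m j ≠ nn k) (d : ℕ) :
    HF (starConfig ℓ ∪ starConfig m ∪ starConfig nn) d =
      (expGE d (d + 1 - (t - 1)) 0 0 ∪ expGE d 0 (d + 1 - (r - 1)) 0 ∪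
        expGE d 0 0 (d + 1 - (s - 1))).card := by
  obtain ⟨q, hq, hirr, rfl⟩ := hγ
  obtain ⟨T, hT⟩ := exists_conic_normal_form hq hirr
  have hγ' : {p : P2 | eval p.rep q = 0} =
      {p : P2 | T p.rep 1 ^ 2 - 4 * T p.rep 0 * T p.rep 2 = 0} :=
    Set.ext fun p => by rw [Set.mem_ofPred_eq, Set.mem_ofPred_eq, hT]
  choose u₁ w₁ h01 hL₁ using fun i => exists_eq_tangentForm hγ' (hℓline i) (hℓtan i)
  choose u₂ w₂ h02 hL₂ using fun i => exists_eq_tangentForm hγ' (hmline i) (hmtan i)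
  choose u₃ w₃ h03 hL₃ using fun i => exists_eq_tangentForm hγ' (hnline i) (hntan i)
  have h₁ : ∀ i j, i ≠ j → u₁ i * w₁ j ≠ u₁ j * w₁ i := fun i j hij =>
    mul_ne_mul_of_ne (h01 i) (h01 j) (hL₁ i) (hL₁ j) (hℓinj.ne hij)
  have h₂ : ∀ i j, i ≠ j → u₂ i * w₂ j ≠ u₂ j * w₂ i := fun i j hij =>
    mul_ne_mul_of_ne (h02 i) (h02 j) (hL₂ i) (hL₂ j) (hminj.ne hij)
  have h₃ : ∀ i j, i ≠ j → u₃ i * w₃ j ≠ u₃ j * w₃ i := fun i j hij =>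
    mul_ne_mul_of_ne (h03 i) (h03 j) (hL₃ i) (hL₃ j) (hninj.ne hij)
  rw [HF_eq_finrank_skewIn T h₁ h₂ h₃ _ d fun F hF => by
    rw [← forall_starConfig_eval_eq_zero_iff hL₁ h₁ hF,
      ← forall_starConfig_eval_eq_zero_iff hL₂ h₂ hF,
      ← forall_starConfig_eval_eq_zero_iff hL₃ h₃ hF]
    simp only [Set.mem_union, or_imp, forall_and, and_assoc]]
  rcases le_or_gt (d + 2) t with hd | hd
  · rw [finrank_skewIn_powVec_of_le hd _ _ h₃, card_expGE_union_of_le hd]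
  · have e₁ := finrank_skewIn_powVec (d + 2) h01 h02 h03 h₁ h₂ h₃
      (fun i j => mul_ne_mul_of_ne (h01 i) (h02 j) (hL₁ i) (hL₂ j) (hℓm i j))
      (fun i j => mul_ne_mul_of_ne (h01 i) (h03 j) (hL₁ i) (hL₃ j) (hℓn i j))
      (fun i j => mul_ne_mul_of_ne (h02 i) (h03 j) (hL₂ i) (hL₃ j) (hmn i j))
      (by omega) (by omega) (by omega) (by omega)
    have e₂ := card_expGE_union (r := r) (s := s) (t := t) (d := d)
      (by omega) (by omega) (by omega) hr hs (by omega) (by omega)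
    exact_mod_cast Nat.add_right_cancel (e₁.trans e₂.symm)

lemma choose_two_eq_add (a : ℕ) : a.choose 2 = (a - 1).choose 2 + (a - 1) := by
  cases a with
  | zero => rfl
  | succ a => rw [Nat.choose_succ_succ' a 1, Nat.choose_one_right, Nat.add_sub_cancel, add_comm]

end ThreeStars

/-- **Three contact star configurations have the h-vector of three fat points.**
Let `γ` be an irreducible conic and `X = 𝕊(ℓ₁,…,ℓ_r)`, `Y = 𝕊(m₁,…,m_s)`,
`W = 𝕊(n₁,…,n_t)` contact star configurations on `γ` defined by `r+s+t` pairwise distinct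
tangent lines, `t ≥ r ≥ s ≥ 2`, `t ∈ {r+s−1, r+s, r+s+1}`.  Let `p₁, p₂, p₃` be
non-collinear points and `Z = (t−1)p₁ + (r−1)p₂ + (s−1)p₃`.  Then
`h_{X∪Y∪W} = h_Z`, and explicitly: `h(d) = d+1` for `0 ≤ d ≤ t−2`,
`h(d) = r+s−2−2(d−t+1)` for `t−1 ≤ d ≤ t+s−3`, `h(d) = r−s−(d−(t+s−2))` for
`t+s−2 ≤ d ≤ t+r−3`, and `h(d) = 0` for `d ≥ t+r−2`. -/
theorem hvector_three_contact_stars_eq_three_fat_points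
    (γ : Set P2) (hγ : IsIrredConic γ) (r s t : ℕ)
    (hs : 2 ≤ s) (hsr : s ≤ r) (hrt : r ≤ t)
    (htv : t = r + s - 1 ∨ t = r + s ∨ t = r + s + 1)
    (ℓ : Fin r → Set P2) (m : Fin s → Set P2) (nn : Fin t → Set P2)
    (hℓline : ∀ i, IsLine (ℓ i)) (hmline : ∀ j, IsLine (m j)) (hnline : ∀ k, IsLine (nn k))
    (hℓtan : ∀ i, IsTangent (ℓ i) γ) (hmtan : ∀ j, IsTangent (m j) γ)
    (hntan : ∀ k, IsTangent (nn k) γ)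
    (hℓinj : Function.Injective ℓ) (hminj : Function.Injective m)
    (hninj : Function.Injective nn)
    (hℓm : ∀ i j, ℓ i ≠ m j) (hℓn : ∀ i k, ℓ i ≠ nn k) (hmn : ∀ j k, m j ≠ nn k)
    (p₁ p₂ p₃ : P2)
    (hncol : ¬ ∃ L : Set P2, IsLine L ∧ p₁ ∈ L ∧ p₂ ∈ L ∧ p₃ ∈ L) :
    (∀ d : ℕ, hvec (starConfig ℓ ∪ starConfig m ∪ starConfig nn) d =
      hvecI (pointIdeal p₁ ^ (t - 1) ⊓ pointIdeal p₂ ^ (r - 1) ⊓ pointIdeal p₃ ^ (s - 1)) d) ∧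
    (∀ d : ℕ, d ≤ t - 2 →
      hvec (starConfig ℓ ∪ starConfig m ∪ starConfig nn) d = (d : ℤ) + 1) ∧
    (∀ d : ℕ, t - 1 ≤ d → d ≤ t + s - 3 →
      hvec (starConfig ℓ ∪ starConfig m ∪ starConfig nn) d =
        (r : ℤ) + (s : ℤ) - 2 - 2 * ((d : ℤ) - (t : ℤ) + 1)) ∧
    (∀ d : ℕ, t + s - 2 ≤ d → d ≤ t + r - 3 →
      hvec (starConfig ℓ ∪ starConfig m ∪ starConfig nn) d =
        (r : ℤ) - (s : ℤ) - ((d : ℤ) - ((t : ℤ) + (s : ℤ) - 2))) ∧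
    (∀ d : ℕ, t + r - 2 ≤ d →
      hvec (starConfig ℓ ∪ starConfig m ∪ starConfig nn) d = 0) := by
  have hHF := HF_three_contact_stars hγ (by omega) (by omega) hrt (by omega) (by omega)
    hℓline hmline hnline hℓtan hmtan hntan hℓinj hminj hninj hℓm hℓn hmn
  have hHFI := HFI_three_fat_points ![p₁, p₂, p₃]
    (fun ⟨L, hL, h⟩ => hncol ⟨L, hL, h 0, h 1, h 2⟩) (t - 1) (r - 1) (s - 1)
  have hlow : ∀ d, d + 2 ≤ t →
      HF (starConfig ℓ ∪ starConfig m ∪ starConfig nn) d = ((d + 2).choose 2 : ℕ) := fun d hd => by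
    rw [hHF, card_expGE_union_of_le hd]
  have hhigh : ∀ d, t ≤ d + 1 → HF (starConfig ℓ ∪ starConfig m ∪ starConfig nn) d +
      (((t + r - (d + 2)).choose 2 : ℕ) + ((t + s - (d + 2)).choose 2 : ℕ)) =
      (r.choose 2 : ℕ) + (s.choose 2 : ℕ) + (t.choose 2 : ℕ) := fun d hd => by
    rw [hHF]
    exact_mod_cast card_expGE_union (by omega) (by omega) hd (by omega) (by omega) (by omega)
      (by omega)
  have hstep : ∀ d, t ≤ d + 1 → hvec (starConfig ℓ ∪ starConfig m ∪ starConfig nn) d =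
      ((t + r - (d + 2) : ℕ) : ℤ) + ((t + s - (d + 2) : ℕ) : ℤ) := by
    intro d hd
    obtain ⟨d, rfl⟩ := Nat.exists_eq_add_one.2 (show 0 < d by omega)
    have h1 := hhigh (d + 1) hd
    have e1 := choose_two_eq_add (t + r - (d + 2))
    have e2 := choose_two_eq_add (t + s - (d + 2))
    rw [Nat.sub_sub, show d + 2 + 1 = d + 1 + 2 by omega] at e1 e2
    rw [hvec]
    rcases le_or_gt t (d + 1) with hd' | hd'
    · have h2 := hhigh d hd'
      omega
    · obtain rfl : t = d + 2 := by omega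
      have h2 := hlow d le_rfl
      rw [Nat.add_sub_cancel_left] at e1 e2
      omega
  refine ⟨fun d => ?_, fun d hd => ?_, fun d hd hd' => ?_, fun d hd hd' => ?_, fun d hd => ?_⟩
  · cases d with
    | zero => exact (hHF 0).trans (hHFI 0).symm
    | succ d => exact congrArg₂ (· - ·) ((hHF _).trans (hHFI _).symm) ((hHF _).trans (hHFI _).symm)
  · cases d with
    | zero => rw [hvec, hlow 0 (by omega)]; rfl
    | succ d =>
      have e : (d + 1 + 2).choose 2 = (d + 2).choose 2 + (d + 2) := choose_two_eq_add (d + 1 + 2)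
      rw [hvec, hlow _ (by omega), hlow _ (by omega), e]
      push_cast
      ring
  · rw [hstep d (by omega)]
    omega
  · rw [hstep d (by omega)]
    omega
  · rw [hstep d (by omega)]
    omega

end
end

section
/- Let γ ⊂ ℙ² be an irreducible conic and let ℓ₁,…,ℓ₈ be eight pairwise distinct lines tangent to γ; set A_i = ℓ_{i−1} ∩ ℓ_i for i = 1,…,8 (indices mod 8, ℓ₀ = ℓ₈), so A₁,…,A₈ are the vertices of an octagon circumscribed to γ whose side through A_i and A_{i+1} is ℓ_i. Let P₁ = ℓ₈ ∩ ℓ₂ and P₂ = ℓ₁ ∩ ℓ₃. Suppose the space of quadratic forms vanishing at A₁, A₂, A₅, A₆, P₁ is one-dimensional, spanned by q₁ with zero locus γ₁, and likewise the space of quadratic forms vanishing at A₂, A₃, A₆, A₇, P₂ is one-dimensional, spanned by q₂ with zero locus γ₂. Then every point of γ₁ ∩ γ₂ other than A₂ and A₆ lies on the line through A₄ and A₈; in particular the four points A₄, A₈ and the two points of (γ₁ ∩ γ₂) ∖ {A₂, A₆} are collinear. -/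
open MvPolynomial

noncomputable section

/-- A quadratic form in three variables, written out by its six coefficients. -/
theorem exists_coeffs_of_isHomogeneous_two {q : MvPolynomial (Fin 3) ℂ}
    (hq : q.IsHomogeneous 2) :
    ∃ a b c d e f : ℂ, ∀ v : Fin 3 → ℂ, eval v q =
      a * v 0 ^ 2 + b * v 1 ^ 2 + c * v 2 ^ 2 + d * (v 0 * v 1) + e * (v 0 * v 2)
        + f * (v 1 * v 2) := by
  rw [← MvPolynomial.support_sum_monomial_coeff q]
  refine Finset.sum_induction (s := q.support) (fun m => monomial m (coeff m q))
    (fun q : MvPolynomial (Fin 3) ℂ => ∃ a b c d e f : ℂ, ∀ v : Fin 3 → ℂ, eval v q =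
      a * v 0 ^ 2 + b * v 1 ^ 2 + c * v 2 ^ 2 + d * (v 0 * v 1) + e * (v 0 * v 2)
        + f * (v 1 * v 2)) ?_ ?_ ?_
  · rintro p r ⟨a, b, c, d, e, f, h⟩ ⟨a', b', c', d', e', f', h'⟩
    refine ⟨a + a', b + b', c + c', d + d', e + e', f + f', fun v => ?_⟩
    rw [map_add, h, h']
    ring
  · exact ⟨0, 0, 0, 0, 0, 0, fun v => by simp⟩
  · intro m hm
    have hdeg : m 0 + m 1 + m 2 = 2 := by
      have := hq (mem_support_iff.mp hm)
      simpa [Finsupp.weight_apply, Finsupp.sum_fintype, Fin.sum_univ_three] using this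
    have key : ∀ v : Fin 3 → ℂ, eval v (monomial m (coeff m q)) =
        coeff m q * (v 0 ^ m 0 * v 1 ^ m 1 * v 2 ^ m 2) := by
      intro v
      rw [eval_monomial, Finsupp.prod_fintype _ _ (by simp), Fin.prod_univ_three]
    simp only [key]
    clear key
    generalize coeff m q = k
    generalize m 0 = i at *
    generalize m 1 = j at *
    generalize m 2 = l at *
    have hcases : (i = 0 ∧ j = 0 ∧ l = 2) ∨ (i = 0 ∧ j = 1 ∧ l = 1) ∨ (i = 0 ∧ j = 2 ∧ l = 0) ∨
        (i = 1 ∧ j = 0 ∧ l = 1) ∨ (i = 1 ∧ j = 1 ∧ l = 0) ∨ (i = 2 ∧ j = 0 ∧ l = 0) := by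
      omega
    rcases hcases with ⟨rfl, rfl, rfl⟩ | ⟨rfl, rfl, rfl⟩ | ⟨rfl, rfl, rfl⟩ | ⟨rfl, rfl, rfl⟩ |
      ⟨rfl, rfl, rfl⟩ | ⟨rfl, rfl, rfl⟩
    · exact ⟨0, 0, k, 0, 0, 0, fun v => by norm_num⟩
    · exact ⟨0, 0, 0, 0, 0, k, fun v => by norm_num⟩
    · exact ⟨0, k, 0, 0, 0, 0, fun v => by norm_num⟩
    · exact ⟨0, 0, 0, 0, k, 0, fun v => by norm_num⟩
    · exact ⟨0, 0, 0, k, 0, 0, fun v => by norm_num⟩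
    · exact ⟨k, 0, 0, 0, 0, 0, fun v => by norm_num⟩

/-- The polarization of a quadratic form in three variables. -/
theorem exists_polar_of_isHomogeneous_two {q : MvPolynomial (Fin 3) ℂ}
    (hq : q.IsHomogeneous 2) :
    ∃ B : (Fin 3 → ℂ) → (Fin 3 → ℂ) → ℂ, ∀ (u n w : Fin 3 → ℂ) (x y z : ℂ),
      eval (x • u + y • n + z • w) q = x ^ 2 * eval u q + y ^ 2 * eval n q + z ^ 2 * eval w q
        + x * y * B u n + x * z * B u w + y * z * B n w := by
  obtain ⟨a, b, c, d, e, f, h⟩ := exists_coeffs_of_isHomogeneous_two hq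
  refine ⟨fun u v => a * (2 * u 0 * v 0) + b * (2 * u 1 * v 1) + c * (2 * u 2 * v 2)
    + d * (u 0 * v 1 + u 1 * v 0) + e * (u 0 * v 2 + u 2 * v 0)
    + f * (u 1 * v 2 + u 2 * v 1), fun u n w x y z => ?_⟩
  simp only [h, Pi.add_apply, Pi.smul_apply, smul_eq_mul]
  ring

/-- The polynomial of a linear functional. -/
def linPoly (φ : (Fin 3 → ℂ) →ₗ[ℂ] ℂ) : MvPolynomial (Fin 3) ℂ :=
  ∑ i, C (φ (Pi.single i 1)) * X i

theorem eval_linPoly (φ : (Fin 3 → ℂ) →ₗ[ℂ] ℂ) (v : Fin 3 → ℂ) :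
    eval v (linPoly φ) = φ v := by
  rw [LinearMap.pi_apply_eq_sum_univ φ v]
  simp only [linPoly, map_sum, map_mul, eval_C, eval_X, smul_eq_mul, mul_comm]
  refine Finset.sum_congr rfl fun i _ => ?_
  congr 2
  ext j
  simp [Pi.single_apply, eq_comm]

theorem isHomogeneous_linPoly (φ : (Fin 3 → ℂ) →ₗ[ℂ] ℂ) : (linPoly φ).IsHomogeneous 1 :=
  IsHomogeneous.sum _ _ _ fun i _ => by
    simpa using (isHomogeneous_C (Fin 3) (φ (Pi.single i 1))).mul (isHomogeneous_X ℂ i)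

/-- An irreducible polynomial is not a product of two linear forms. -/
theorem not_eval_eq_mul_of_irreducible {q : MvPolynomial (Fin 3) ℂ} (hq : Irreducible q)
    (φ ψ : (Fin 3 → ℂ) →ₗ[ℂ] ℂ) : ¬ ∀ v, eval v q = φ v * ψ v := by
  intro h
  have hmul : q = linPoly φ * linPoly ψ := by
    refine MvPolynomial.funext fun v => ?_
    rw [map_mul, eval_linPoly, eval_linPoly, h]
  have hnu : ∀ χ : (Fin 3 → ℂ) →ₗ[ℂ] ℂ, ¬ IsUnit (linPoly χ) := by
    intro χ hu
    have := hu.map (eval (0 : Fin 3 → ℂ))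
    rw [eval_linPoly, map_zero] at this
    exact not_isUnit_zero this
  exact (hq.isUnit_or_isUnit hmul).elim (hnu φ) (hnu ψ)

theorem exists_binary_quadratic_eq_mul (a b c : ℂ) :
    ∃ α β δ ε : ℂ, ∀ x z : ℂ,
      a * x ^ 2 + b * (x * z) + c * z ^ 2 = (α * x + β * z) * (δ * x + ε * z) := by
  by_cases ha : a = 0
  · exact ⟨0, 1, b, c, fun x z => by rw [ha]; ring⟩
  · obtain ⟨s, hs⟩ := IsAlgClosed.exists_pow_nat_eq (b ^ 2 - 4 * a * c) (n := 2) two_pos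
    refine ⟨a, (b + s) / 2, 1, (b - s) / (2 * a), fun x z => ?_⟩
    field_simp
    linear_combination z ^ 2 * hs

theorem IsLine.exists_linearMap {L : Set P2} (hL : IsLine L) :
    ∃ f : (Fin 3 → ℂ) →ₗ[ℂ] ℂ, f ≠ 0 ∧ ∀ p : P2, p ∈ L ↔ f p.rep = 0 := by
  obtain ⟨a, ha, rfl⟩ := hL
  refine ⟨∑ i, a i • LinearMap.proj i, fun h => ha ?_, fun p => by simp⟩
  ext i
  simpa [Pi.single_apply] using LinearMap.congr_fun h (Pi.single i 1)

theorem isLine_of_linearMap {f : (Fin 3 → ℂ) →ₗ[ℂ] ℂ} (hf : f ≠ 0) :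
    IsLine {p : P2 | f p.rep = 0} := by
  have key : ∀ v, (∑ i, f (Pi.single i 1) * v i) = f v := fun v => by
    rw [← eval_linPoly f v]
    simp [linPoly]
  refine ⟨fun i => f (Pi.single i 1), fun h => hf ?_, by simp only [key]⟩
  ext i
  simpa using congr_fun h i

theorem linearMap_rep_mk_eq_zero_iff (f : (Fin 3 → ℂ) →ₗ[ℂ] ℂ) {v : Fin 3 → ℂ} (hv : v ≠ 0) :
    f (Projectivization.mk ℂ v hv).rep = 0 ↔ f v = 0 := by
  obtain ⟨a, ha⟩ := Projectivization.exists_smul_eq_mk_rep ℂ v hv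
  rw [← ha, Units.smul_def, map_smul, smul_eq_mul]
  simp

theorem eval_rep_mk_eq_zero {q : MvPolynomial (Fin 3) ℂ} (hq : q.IsHomogeneous 2)
    {v : Fin 3 → ℂ} (hv : v ≠ 0) (h : eval v q = 0) :
    eval (Projectivization.mk ℂ v hv).rep q = 0 := by
  obtain ⟨a, ha⟩ := Projectivization.exists_smul_eq_mk_rep ℂ v hv
  obtain ⟨B, hB⟩ := exists_polar_of_isHomogeneous_two hq
  have := hB v 0 0 a 0 0
  rw [← ha, Units.smul_def]
  simpa [h] using this

/-- Tangency in terms of representing vectors. -/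
theorem IsTangent.exists_vector {q : MvPolynomial (Fin 3) ℂ} (hq : q.IsHomogeneous 2)
    {L : Set P2} (ht : IsTangent L {p : P2 | eval p.rep q = 0})
    {f : (Fin 3 → ℂ) →ₗ[ℂ] ℂ} (hf : ∀ p : P2, p ∈ L ↔ f p.rep = 0) :
    ∃ p : Fin 3 → ℂ, p ≠ 0 ∧ f p = 0 ∧ eval p q = 0 ∧
      ∀ v, f v = 0 → eval v q = 0 → ∃ c : ℂ, v = c • p := by
  obtain ⟨p, hp⟩ := ht
  have hmem : p ∈ L ∩ {p : P2 | eval p.rep q = 0} := by rw [hp]; rfl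
  refine ⟨p.rep, p.rep_nonzero, (hf p).1 hmem.1, hmem.2, fun v hv hqv => ?_⟩
  by_cases hv0 : v = 0
  · exact ⟨0, by simp [hv0]⟩
  have : Projectivization.mk ℂ v hv0 ∈ L ∩ {p : P2 | eval p.rep q = 0} :=
    ⟨(hf _).2 ((linearMap_rep_mk_eq_zero_iff f hv0).2 hv), eval_rep_mk_eq_zero hq hv0 hqv⟩
  rw [hp, Set.mem_singleton_iff, ← p.mk_rep, Projectivization.mk_eq_mk_iff'] at this
  obtain ⟨c, hc⟩ := this
  exact ⟨c, hc.symm⟩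

/-- Distinct lines: some vector lies on the first but not on the second. -/
theorem exists_apply_eq_zero_of_ne {L M : Set P2} (hne : L ≠ M)
    {f g : (Fin 3 → ℂ) →ₗ[ℂ] ℂ} (hg : g ≠ 0) (hfL : ∀ p : P2, p ∈ L ↔ f p.rep = 0)
    (hgM : ∀ p : P2, p ∈ M ↔ g p.rep = 0) (hf : f ≠ 0) : ∃ u, f u = 0 ∧ g u ≠ 0 := by
  by_contra! hall
  obtain ⟨w, hw⟩ : ∃ w, f w ≠ 0 := by
    by_contra! h
    exact hf (LinearMap.ext h)
  have key : ∀ v, g v * f w = f v * g w := by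
    intro v
    have := hall (f w • v - f v • w) (by simp [mul_comm])
    simp only [map_sub, map_smul, smul_eq_mul] at this
    linear_combination this
  have hgw : g w ≠ 0 := by
    intro h
    refine hg (LinearMap.ext fun v => ?_)
    have := key v
    rw [h, mul_zero] at this
    simpa [hw] using this
  refine hne (Set.ext fun p => ?_)
  rw [hfL, hgM]
  refine ⟨fun h => hall _ h, fun h => ?_⟩
  have := key p.rep
  rw [h, zero_mul] at this
  simpa [hgw] using this.symm

/-- A tangent line is orthogonal to its point of contact. -/
theorem polar_eq_zero_of_isTangent {q : MvPolynomial (Fin 3) ℂ} (hq : q.IsHomogeneous 2)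
    {B : (Fin 3 → ℂ) → (Fin 3 → ℂ) → ℂ}
    (hB : ∀ (u n w : Fin 3 → ℂ) (x y z : ℂ),
      eval (x • u + y • n + z • w) q = x ^ 2 * eval u q + y ^ 2 * eval n q + z ^ 2 * eval w q
        + x * y * B u n + x * z * B u w + y * z * B n w)
    {L : Set P2} (ht : IsTangent L {p : P2 | eval p.rep q = 0})
    {f : (Fin 3 → ℂ) →ₗ[ℂ] ℂ} (hf : ∀ p : P2, p ∈ L ↔ f p.rep = 0)
    {p r : Fin 3 → ℂ} (hp : f p = 0) (hr : f r = 0) (hqp : eval p q = 0)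
    (hind : ∀ x y : ℂ, x • p + y • r = 0 → x = 0 ∧ y = 0) : B p r = 0 := by
  obtain ⟨s, hs0, -, -, hs⟩ := ht.exists_vector hq hf
  obtain ⟨c, hc⟩ := hs p hp hqp
  obtain ⟨d, hd⟩ := hs (eval r q • p + (-B p r) • r) (by simp [hp, hr]) (by
    have := hB p r 0 (eval r q) (-B p r) 0
    rw [smul_zero, add_zero] at this
    rw [this, hqp]
    ring)
  have hc0 : c ≠ 0 := by
    rintro rfl
    have := (hind 1 0 (by simp [hc])).1
    exact one_ne_zero this
  have := (hind (c * eval r q - d) (c * -B p r) (by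
    have h1 : (c * eval r q - d) • p + (c * -B p r) • r =
      c • (eval r q • p + (-B p r) • r) - d • p := by module
    rw [h1, hd, hc]
    module)).2
  simpa [hc0] using this

/-- Coordinates adapted to two tangent lines of an irreducible conic: the two lines are `z = 0`
and `x = 0`, and every other tangent line is `t² x + t y + z = 0` for some `t ≠ 0`. -/
theorem exists_tangent_coordinates {q : MvPolynomial (Fin 3) ℂ} (hq : q.IsHomogeneous 2)
    (hirr : Irreducible q) {L M : Set P2} (hL : IsLine L) (hM : IsLine M) (hLM : L ≠ M)
    (hLt : IsTangent L {p : P2 | eval p.rep q = 0})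
    (hMt : IsTangent M {p : P2 | eval p.rep q = 0}) (hne : (L ∩ M).Nonempty) :
    ∃ x y z : (Fin 3 → ℂ) →ₗ[ℂ] ℂ, (∀ a b c : ℂ, ∃ v, x v = a ∧ y v = b ∧ z v = c) ∧
      (∀ p : P2, p ∈ L ↔ z p.rep = 0) ∧ (∀ p : P2, p ∈ M ↔ x p.rep = 0) ∧
      ∀ N : Set P2, IsLine N → IsTangent N {p : P2 | eval p.rep q = 0} → N ≠ L → N ≠ M →
        ∃ t : ℂ, t ≠ 0 ∧ ∀ p : P2, p ∈ N ↔ t ^ 2 * x p.rep + t * y p.rep + z p.rep = 0 := by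
  obtain ⟨f, hf0, hf⟩ := hL.exists_linearMap
  obtain ⟨g, hg0, hg⟩ := hM.exists_linearMap
  obtain ⟨B, hB⟩ := exists_polar_of_isHomogeneous_two hq
  obtain ⟨P, hPL, hPM⟩ := hne
  obtain ⟨n, hn0, hfn, hgn⟩ : ∃ n : Fin 3 → ℂ, n ≠ 0 ∧ f n = 0 ∧ g n = 0 :=
    ⟨P.rep, P.rep_nonzero, (hf P).1 hPL, (hg P).1 hPM⟩
  have basis_of : ∀ u w : Fin 3 → ℂ, f u = 0 → g u ≠ 0 → g w = 0 → f w ≠ 0 →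
      ∃ b : Module.Basis (Fin 3) ℂ (Fin 3 → ℂ), b 0 = u ∧ b 1 = n ∧ b 2 = w := by
    intro u w hfu hgu hgw hfw
    have hli : LinearIndependent ℂ ![u, n, w] := by
      rw [Fintype.linearIndependent_iff]
      intro c hc
      simp only [Fin.sum_univ_three, Matrix.cons_val_zero, Matrix.cons_val_one,
        Matrix.cons_val] at hc
      have h0 : c 0 = 0 := by simpa [hfu, hgn, hgw, hgu] using congrArg g hc
      have h2 : c 2 = 0 := by simpa [hfu, hfn, hfw] using congrArg f hc
      have h1 : c 1 = 0 := by simpa [h0, h2, hn0] using hc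
      intro i
      fin_cases i <;> assumption
    refine ⟨basisOfLinearIndependentOfCardEqFinrank hli (by simp), ?_, ?_, ?_⟩ <;> simp
  have expand : ∀ (b : Module.Basis (Fin 3) ℂ (Fin 3 → ℂ)) (v : Fin 3 → ℂ),
      b.coord 0 v • b 0 + b.coord 1 v • b 1 + b.coord 2 v • b 2 = v := by
    intro b v
    have := b.sum_repr v
    rwa [Fin.sum_univ_three] at this
  have indep_left : ∀ u, g u ≠ 0 → ∀ x y : ℂ, x • u + y • n = 0 → x = 0 ∧ y = 0 := by
    intro u hu x y h
    have hx : x = 0 := by simpa [hgn, hu] using congrArg g h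
    exact ⟨hx, by simpa [hx, hn0] using h⟩
  have indep_right : ∀ w, f w ≠ 0 → ∀ x y : ℂ, x • w + y • n = 0 → x = 0 ∧ y = 0 := by
    intro w hw x y h
    have hx : x = 0 := by simpa [hfn, hw] using congrArg f h
    exact ⟨hx, by simpa [hx, hn0] using h⟩
  have Bsymm : ∀ u v, B u v = B v u := by
    intro u v
    have h1 := hB u v 0 1 1 0
    have h2 := hB v u 0 1 1 0
    simp only [one_smul, zero_smul, add_zero] at h1 h2
    rw [add_comm v u, h1] at h2
    linear_combination h2
  -- The intersection of the two tangent lines is not on the conic.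
  have hqn : eval n q ≠ 0 := by
    intro hqn
    obtain ⟨u, hfu, hgu⟩ := exists_apply_eq_zero_of_ne hLM hg0 hf hg hf0
    obtain ⟨w, hgw, hfw⟩ := exists_apply_eq_zero_of_ne hLM.symm hf0 hg hf hg0
    obtain ⟨b, rfl, rfl, rfl⟩ := basis_of u w hfu hgu hgw hfw
    have hnu := polar_eq_zero_of_isTangent hq hB hLt hf hfn hfu hqn fun x y h =>
      (indep_left _ hgu y x (by rwa [add_comm])).symm
    have hnw := polar_eq_zero_of_isTangent hq hB hMt hg hgn hgw hqn fun x y h =>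
      (indep_right _ hfw y x (by rwa [add_comm])).symm
    obtain ⟨α, β, δ, ε, hfac⟩ := exists_binary_quadratic_eq_mul (eval (b 0) q) (B (b 0) (b 2))
      (eval (b 2) q)
    refine not_eval_eq_mul_of_irreducible hirr (α • b.coord 0 + β • b.coord 2)
      (δ • b.coord 0 + ε • b.coord 2) fun v => ?_
    conv_lhs => rw [← expand b v]
    rw [hB, hqn, hnw, Bsymm, hnu]
    simp only [LinearMap.add_apply, LinearMap.smul_apply, smul_eq_mul]
    rw [← hfac]
    ring
  obtain ⟨u, hu0, hfu, hqu, -⟩ := hLt.exists_vector hq hf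
  obtain ⟨w, hw0, hgw, hqw, -⟩ := hMt.exists_vector hq hg
  -- A common zero of `f` and `g` is proportional to `n`.
  have prop_n : ∀ v, f v = 0 → g v = 0 → ∃ c : ℂ, v = c • n := by
    intro v hfv hgv
    obtain ⟨u, hfu, hgu⟩ := exists_apply_eq_zero_of_ne hLM hg0 hf hg hf0
    obtain ⟨w, hgw, hfw⟩ := exists_apply_eq_zero_of_ne hLM.symm hf0 hg hf hg0
    obtain ⟨b, rfl, rfl, rfl⟩ := basis_of u w hfu hgu hgw hfw
    have h := expand b v
    have h0 : b.coord 0 v = 0 := by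
      have := congrArg g h
      simpa only [map_add, map_smul, hgn, hgw, hgv, smul_eq_mul, mul_zero, add_zero,
        mul_eq_zero, hgu, or_false] using this
    have h2 : b.coord 2 v = 0 := by
      have := congrArg f h
      simpa only [map_add, map_smul, hfn, hfu, hfv, smul_eq_mul, mul_zero, zero_add,
        mul_eq_zero, hfw, or_false] using this
    rw [h0, h2] at h
    exact ⟨b.coord 1 v, by simpa using h.symm⟩
  have not_common : ∀ v, v ≠ 0 → eval v q = 0 → f v = 0 → g v ≠ 0 := by
    intro v hv0 hqv hfv hgv
    obtain ⟨c, rfl⟩ := prop_n v hfv hgv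
    have hc : c ≠ 0 := by
      rintro rfl
      exact hv0 (zero_smul _ _)
    have := hB n 0 0 c 0 0
    simp only [smul_zero, add_zero, hqv] at this
    simp [hc, hqn] at this
  have hgu : g u ≠ 0 := not_common u hu0 hqu hfu
  have hfw : f w ≠ 0 := fun h => not_common w hw0 hqw h hgw
  have hun := polar_eq_zero_of_isTangent hq hB hLt hf hfu hfn hqu (indep_left _ hgu)
  have hwn := polar_eq_zero_of_isTangent hq hB hMt hg hgw hgn hqw (indep_right _ hfw)
  obtain ⟨b, rfl, rfl, rfl⟩ := basis_of u w hfu hgu hgw hfw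
  have hqv : ∀ x y z : ℂ, eval (x • b 0 + y • b 1 + z • b 2) q =
      y ^ 2 * eval (b 1) q + x * z * B (b 0) (b 2) := by
    intro x y z
    rw [hB, hqu, hqw, hun, Bsymm (b 1), hwn]
    ring
  have hB02 : B (b 0) (b 2) ≠ 0 := by
    intro h
    refine not_eval_eq_mul_of_irreducible hirr (eval (b 1) q • b.coord 1) (b.coord 1) fun v => ?_
    conv_lhs => rw [← expand b v]
    rw [hqv, h]
    simp only [LinearMap.smul_apply, smul_eq_mul]
    ring
  obtain ⟨k, hk⟩ : ∃ k : ℂ, k * B (b 0) (b 2) = - eval (b 1) q :=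
    ⟨- eval (b 1) q / B (b 0) (b 2), by field_simp⟩
  have hk0 : k ≠ 0 := by
    rintro rfl
    rw [zero_mul] at hk
    exact hqn (neg_eq_zero.mp hk.symm)
  have hfv : ∀ v, f v = b.coord 2 v * f (b 2) := by
    intro v
    conv_lhs => rw [← expand b v]
    simp only [map_add, map_smul, hfu, hfn, smul_eq_mul]
    ring
  have hgv : ∀ v, g v = b.coord 0 v * g (b 0) := by
    intro v
    conv_lhs => rw [← expand b v]
    simp only [map_add, map_smul, hgw, hgn, smul_eq_mul]
    ring
  refine ⟨k⁻¹ • b.coord 0, (-2 : ℂ) • b.coord 1, b.coord 2, fun x y z => ?_, fun p => ?_,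
    fun p => ?_, fun N hN hNt hNL hNM => ?_⟩
  · refine ⟨(k * x) • b 0 + (-y / 2) • b 1 + z • b 2, ?_, ?_, ?_⟩
    · simp [hk0]
    · simp
      ring
    · simp
  · rw [hf, hfv]
    simp [hfw]
  · rw [hg, hgv]
    simp [hgu, hk0]
  obtain ⟨h, hh0, hh⟩ := hN.exists_linearMap
  obtain ⟨s, -, -, hqs, hs⟩ := hNt.exists_vector hq hh
  have hs02 : b.coord 0 s * b.coord 2 s = k * b.coord 1 s ^ 2 := by
    rw [← expand b s, hqv] at hqs
    refine mul_right_cancel₀ hB02 ?_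
    linear_combination hqs - b.coord 1 s ^ 2 * hk
  have hhv : ∀ v, h v = k * h (b 0) * (k⁻¹ * b.coord 0 v) + h (b 1) * b.coord 1 v
      + h (b 2) * b.coord 2 v := by
    intro v
    conv_lhs => rw [← expand b v]
    simp only [map_add, map_smul, smul_eq_mul]
    field_simp
  set α := k * h (b 0) with hα
  set β := h (b 1) with hβ
  set δ := h (b 2) with hδ
  -- Two points of the line and the conic coincide.
  have huniq : ∀ x y x' y' : ℂ, α * x ^ 2 + β * (x * y) + δ * y ^ 2 = 0 →
      α * x' ^ 2 + β * (x' * y') + δ * y' ^ 2 = 0 → x * y' = x' * y := by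
    have hpt : ∀ x y : ℂ, α * x ^ 2 + β * (x * y) + δ * y ^ 2 = 0 →
        ∃ c : ℂ, (k * x ^ 2) • b 0 + (x * y) • b 1 + (y ^ 2) • b 2 = c • s := by
      intro x y hxy
      refine hs _ ?_ ?_
      · simp only [map_add, map_smul, smul_eq_mul, ← hβ, ← hδ]
        linear_combination hxy + x ^ 2 * hα
      · rw [hqv]
        linear_combination x ^ 2 * y ^ 2 * hk
    intro x y x' y' hxy hxy'
    obtain ⟨c, hc⟩ := hpt x y hxy
    obtain ⟨c', hc'⟩ := hpt x' y' hxy'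
    have e : ∀ i, b.coord i ((k * x ^ 2) • b 0 + (x * y) • b 1 + (y ^ 2) • b 2) =
      c * b.coord i s := fun i => by rw [hc, map_smul, smul_eq_mul]
    have e' : ∀ i, b.coord i ((k * x' ^ 2) • b 0 + (x' * y') • b 1 + (y' ^ 2) • b 2) =
      c' * b.coord i s := fun i => by rw [hc', map_smul, smul_eq_mul]
    have e0 := e 0
    have e1 := e 1
    have e2 := e 2
    have e0' := e' 0
    have e1' := e' 1
    have e2' := e' 2
    have hs02' := hs02
    simp at e0 e1 e2 e0' e1' e2' hs02'
    have hsq : k * (x * y' - x' * y) ^ 2 = 0 := by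
      linear_combination y' ^ 2 * e0 + c * b.repr s 0 * e2' - 2 * k * x' * y' * e1
        - 2 * k * c * b.repr s 1 * e1' + y ^ 2 * e0' + c' * b.repr s 0 * e2
        + 2 * c * c' * hs02'
    have := pow_eq_zero_iff (two_ne_zero) |>.1 ((mul_eq_zero.1 hsq).resolve_left hk0)
    linear_combination this
  have hdisc : β ^ 2 = 4 * α * δ := by
    by_cases hδ0 : δ = 0
    · have := huniq 0 1 β (-α) (by rw [hδ0]; ring) (by rw [hδ0]; ring)
      rw [hδ0]
      linear_combination (-β) * this
    · obtain ⟨d, hd⟩ := IsAlgClosed.exists_pow_nat_eq (β ^ 2 - 4 * α * δ) (n := 2) two_pos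
      have := huniq (2 * δ) (-β + d) (2 * δ) (-β - d)
        (by linear_combination δ * hd) (by linear_combination δ * hd)
      have hd0 : δ * d = 0 := by linear_combination (-1 / 4 : ℂ) * this
      have hd0 : d = 0 := (mul_eq_zero.1 hd0).resolve_left hδ0
      rw [hd0] at hd
      linear_combination -hd
  have hδ0 : δ ≠ 0 := by
    intro hδ0
    have hβ0 : β = 0 := by
      rw [hδ0, mul_zero] at hdisc
      exact pow_eq_zero_iff two_ne_zero |>.1 hdisc
    have hα0 : α ≠ 0 := by
      intro hα0
      refine hh0 (LinearMap.ext fun v => ?_)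
      rw [hhv, hα0, hβ0, hδ0]
      simp
    refine hNM (Set.ext fun p => ?_)
    rw [hh, hg, hhv, hgv, hβ0, hδ0]
    simp [hα0, hk0, hgu]
  obtain ⟨t, ht⟩ : ∃ t : ℂ, β = -2 * δ * t := ⟨β / (-2 * δ), by field_simp⟩
  have hαt : α = δ * t ^ 2 := by
    have h4 : 4 * δ * (α - δ * t ^ 2) = 0 := by
      rw [ht] at hdisc
      linear_combination -hdisc
    have := (mul_eq_zero.1 h4).resolve_left (by simpa using hδ0)
    linear_combination this
  have hht : ∀ v, h v = δ * (t ^ 2 * (k⁻¹ * b.coord 0 v) + t * (-2 * b.coord 1 v)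
      + b.coord 2 v) := by
    intro v
    rw [hhv, ht, hαt]
    ring
  refine ⟨t, ?_, fun p => ?_⟩
  · rintro rfl
    refine hNL (Set.ext fun p => ?_)
    rw [hh, hf, hht, hfv]
    simp [hδ0, hfw]
  · rw [hh, hht]
    simp only [mul_eq_zero, hδ0, false_or, LinearMap.smul_apply, smul_eq_mul]

/-- Coordinates of the intersection of two distinct tangent lines. -/
theorem coords_of_mem_two_tangents {s t x y z : ℂ} (hst : s ≠ t)
    (hs : s ^ 2 * x + s * y + z = 0) (ht : t ^ 2 * x + t * y + z = 0) :
    y = -(s + t) * x ∧ z = s * t * x := by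
  have hy : y = -(s + t) * x := by
    refine mul_left_cancel₀ (sub_ne_zero.2 hst) ?_
    linear_combination hs - ht
  refine ⟨hy, ?_⟩
  rw [hy] at hs
  linear_combination hs

/-- The conic through the vertices of the triangle cut out by `z`, `x` and `t² x + t y + z`,
and through the intersections of the tangent lines with parameters `r, s` and `s, u`. -/
def tangentConic (x y z : (Fin 3 → ℂ) →ₗ[ℂ] ℂ) (t r s u : ℂ) : MvPolynomial (Fin 3) ℂ :=
  C (-((t - r) * (t - s) * (t - u))) * (linPoly x * linPoly z) +
    linPoly (t • z - (r * s * u) • x) * linPoly (t ^ 2 • x + t • y + z)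

theorem isHomogeneous_tangentConic (x y z : (Fin 3 → ℂ) →ₗ[ℂ] ℂ) (t r s u : ℂ) :
    (tangentConic x y z t r s u).IsHomogeneous 2 := by
  refine IsHomogeneous.add ?_ ((isHomogeneous_linPoly _).mul (isHomogeneous_linPoly _))
  exact zero_add 2 ▸ (isHomogeneous_C (Fin 3) _).mul
    ((isHomogeneous_linPoly x).mul (isHomogeneous_linPoly z))

theorem eval_tangentConic (x y z : (Fin 3 → ℂ) →ₗ[ℂ] ℂ) (t r s u : ℂ) (v : Fin 3 → ℂ) :
    eval v (tangentConic x y z t r s u) =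
      -((t - r) * (t - s) * (t - u)) * (x v * z v) +
        (t * z v - r * s * u * x v) * (t ^ 2 * x v + t * y v + z v) := by
  simp [tangentConic, eval_linPoly]

/-- **A Brianchon-like theorem for octagons circumscribed to a conic.**
Let `ℓ₀,…,ℓ₇` (indices mod 8) be eight pairwise distinct lines tangent to an irreducible
conic `γ`, with vertices `A i = ℓ (i−1) ∩ ℓ i` (so `A 0,…,A 7` are the vertices
`A₁,…,A₈` of the circumscribed octagon).  Let `P₁ = ℓ₈ ∩ ℓ₂` and `P₂ = ℓ₁ ∩ ℓ₃`
(paper numbering; here `Pt1`, `Pt2`).  Suppose the quadratic forms through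
`A₁, A₂, A₅, A₆, P₁` form a one-dimensional space spanned by `q₁` (conic `γ₁`), and
similarly `q₂` for `A₂, A₃, A₆, A₇, P₂` (conic `γ₂`).  Then every point of `γ₁ ∩ γ₂`
other than `A₂, A₆` lies on the line through `A₄` and `A₈`. -/
theorem octagon_brianchon_like
    (γ : Set P2) (hγ : IsIrredConic γ) (ℓ : Fin 8 → Set P2)
    (hline : ∀ i, IsLine (ℓ i)) (htan : ∀ i, IsTangent (ℓ i) γ)
    (hinj : Function.Injective ℓ)
    (A : Fin 8 → P2) (hA : ∀ i : Fin 8, ℓ (i - 1) ∩ ℓ i = {A i})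
    (Pt1 Pt2 : P2) (hPt1 : ℓ 7 ∩ ℓ 1 = {Pt1}) (hPt2 : ℓ 0 ∩ ℓ 2 = {Pt2})
    (q₁ q₂ : MvPolynomial (Fin 3) ℂ)
    (hq₁0 : q₁ ≠ 0) (hq₁2 : q₁.IsHomogeneous 2)
    (hq₁v : ∀ p ∈ ({A 0, A 1, A 4, A 5, Pt1} : Set P2), eval p.rep q₁ = 0)
    (hq₁span : ∀ q : MvPolynomial (Fin 3) ℂ, q.IsHomogeneous 2 →
      (∀ p ∈ ({A 0, A 1, A 4, A 5, Pt1} : Set P2), eval p.rep q = 0) → ∃ c : ℂ, q = c • q₁)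
    (hq₂0 : q₂ ≠ 0) (hq₂2 : q₂.IsHomogeneous 2)
    (hq₂v : ∀ p ∈ ({A 1, A 2, A 5, A 6, Pt2} : Set P2), eval p.rep q₂ = 0)
    (hq₂span : ∀ q : MvPolynomial (Fin 3) ℂ, q.IsHomogeneous 2 →
      (∀ p ∈ ({A 1, A 2, A 5, A 6, Pt2} : Set P2), eval p.rep q = 0) → ∃ c : ℂ, q = c • q₂) :
    ∃ L : Set P2, IsLine L ∧ A 3 ∈ L ∧ A 7 ∈ L ∧
      ∀ p : P2, eval p.rep q₁ = 0 → eval p.rep q₂ = 0 → p ≠ A 1 → p ≠ A 5 → p ∈ L := by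
  obtain ⟨q, hq, hirr, rfl⟩ := hγ
  have hne : ∀ {i j : Fin 8}, i ≠ j → ℓ i ≠ ℓ j := fun hij h => hij (hinj h)
  have hmem : ∀ i : Fin 8, A i ∈ ℓ (i - 1) ∧ A i ∈ ℓ i := fun i => by
    have h : A i ∈ ℓ (i - 1) ∩ ℓ i := by rw [hA i]; rfl
    exact h
  have hPt1' : Pt1 ∈ ℓ 7 ∧ Pt1 ∈ ℓ 1 := by
    have h : Pt1 ∈ ℓ 7 ∩ ℓ 1 := by rw [hPt1]; rfl
    exact h
  have hPt2' : Pt2 ∈ ℓ 0 ∧ Pt2 ∈ ℓ 2 := by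
    have h : Pt2 ∈ ℓ 0 ∩ ℓ 2 := by rw [hPt2]; rfl
    exact h
  obtain ⟨x, y, z, hsurj, hℓ0, hℓ1, hℓ⟩ := exists_tangent_coordinates hq hirr (hline 0) (hline 1)
    (hne (by decide)) (htan 0) (htan 1) ⟨A 1, hmem 1⟩
  have hex : ∀ i : Fin 8, ∃ t : ℂ, i ≠ 0 → i ≠ 1 →
      t ≠ 0 ∧ ∀ p : P2, p ∈ ℓ i ↔ t ^ 2 * x p.rep + t * y p.rep + z p.rep = 0 := by
    intro i
    by_cases hi : i ≠ 0 ∧ i ≠ 1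
    · obtain ⟨t, ht⟩ := hℓ (ℓ i) (hline i) (htan i) (hne hi.1) (hne hi.2)
      exact ⟨t, fun _ _ => ht⟩
    · exact ⟨0, fun h0 h1 => absurd ⟨h0, h1⟩ hi⟩
  choose t ht using hex
  have htne : ∀ i j : Fin 8, i ≠ 0 → i ≠ 1 → j ≠ 0 → j ≠ 1 → i ≠ j → t i ≠ t j := by
    intro i j hi0 hi1 hj0 hj1 hij h
    refine hne hij (Set.ext fun p => ?_)
    rw [(ht i hi0 hi1).2, (ht j hj0 hj1).2, h]
  obtain ⟨t2_ne, hℓ2⟩ := ht 2 (by decide) (by decide)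
  obtain ⟨t3_ne, hℓ3⟩ := ht 3 (by decide) (by decide)
  obtain ⟨t4_ne, hℓ4⟩ := ht 4 (by decide) (by decide)
  obtain ⟨t5_ne, hℓ5⟩ := ht 5 (by decide) (by decide)
  obtain ⟨t6_ne, hℓ6⟩ := ht 6 (by decide) (by decide)
  obtain ⟨t7_ne, hℓ7⟩ := ht 7 (by decide) (by decide)
  have t23 := htne 2 3 (by decide) (by decide) (by decide) (by decide) (by decide)
  have t34 := htne 3 4 (by decide) (by decide) (by decide) (by decide) (by decide)
  have t45 := htne 4 5 (by decide) (by decide) (by decide) (by decide) (by decide)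
  have t56 := htne 5 6 (by decide) (by decide) (by decide) (by decide) (by decide)
  have t67 := htne 6 7 (by decide) (by decide) (by decide) (by decide) (by decide)
  have t26 := htne 2 6 (by decide) (by decide) (by decide) (by decide) (by decide)
  have t27 := htne 2 7 (by decide) (by decide) (by decide) (by decide) (by decide)
  have t73 := htne 7 3 (by decide) (by decide) (by decide) (by decide) (by decide)
  have z0 : z (A 0).rep = 0 := (hℓ0 _).1 (hmem 0).2
  have l0 := (hℓ7 _).1 (hmem 0).1
  have z1 : z (A 1).rep = 0 := (hℓ0 _).1 (hmem 1).1
  have x1 : x (A 1).rep = 0 := (hℓ1 _).1 (hmem 1).2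
  have x2 : x (A 2).rep = 0 := (hℓ1 _).1 (hmem 2).1
  have l2 := (hℓ2 _).1 (hmem 2).2
  obtain ⟨y3, z3⟩ := coords_of_mem_two_tangents t23 ((hℓ2 _).1 (hmem 3).1) ((hℓ3 _).1 (hmem 3).2)
  obtain ⟨y4, z4⟩ := coords_of_mem_two_tangents t34 ((hℓ3 _).1 (hmem 4).1) ((hℓ4 _).1 (hmem 4).2)
  obtain ⟨y5, z5⟩ := coords_of_mem_two_tangents t45 ((hℓ4 _).1 (hmem 5).1) ((hℓ5 _).1 (hmem 5).2)
  obtain ⟨y6, z6⟩ := coords_of_mem_two_tangents t56 ((hℓ5 _).1 (hmem 6).1) ((hℓ6 _).1 (hmem 6).2)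
  obtain ⟨y7, z7⟩ := coords_of_mem_two_tangents t67 ((hℓ6 _).1 (hmem 7).1) ((hℓ7 _).1 (hmem 7).2)
  have xPt1 : x Pt1.rep = 0 := (hℓ1 _).1 hPt1'.2
  have lPt1 := (hℓ7 _).1 hPt1'.1
  have zPt2 : z Pt2.rep = 0 := (hℓ0 _).1 hPt2'.1
  have lPt2 := (hℓ2 _).1 hPt2'.2
  obtain ⟨c₁, hc₁⟩ := hq₁span (tangentConic x y z (t 7) (t 3) (t 4) (t 5))
    (isHomogeneous_tangentConic ..) (by
      simp only [Set.mem_insert_iff, Set.mem_singleton_iff]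
      rintro p (rfl | rfl | rfl | rfl | rfl) <;> rw [eval_tangentConic]
      · rw [z0] at l0 ⊢
        linear_combination (-t 3 * t 4 * t 5 * x (A 0).rep) * l0
      · rw [z1, x1]
        ring
      · rw [y4, z4]
        ring
      · rw [y5, z5]
        ring
      · rw [xPt1] at lPt1 ⊢
        linear_combination (t 7 * z p.rep) * lPt1)
  obtain ⟨c₂, hc₂⟩ := hq₂span (tangentConic x y z (t 2) (t 4) (t 5) (t 6))
    (isHomogeneous_tangentConic ..) (by
      simp only [Set.mem_insert_iff, Set.mem_singleton_iff]
      rintro p (rfl | rfl | rfl | rfl | rfl) <;> rw [eval_tangentConic]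
      · rw [z1, x1]
        ring
      · rw [x2] at l2 ⊢
        linear_combination (t 2 * z (A 2).rep) * l2
      · rw [y5, z5]
        ring
      · rw [y6, z6]
        ring
      · rw [zPt2] at lPt2 ⊢
        linear_combination (-t 4 * t 5 * t 6 * x p.rep) * lPt2)
  -- The linear form through `A 3` and `A 7`.
  let g : (Fin 3 → ℂ) →ₗ[ℂ] ℂ :=
    (t 2 * t 3 * (t 6 + t 7) - t 6 * t 7 * (t 2 + t 3)) • x + (t 2 * t 3 - t 6 * t 7) • y +
      (t 2 + t 3 - t 6 - t 7) • z
  have hg : ∀ v, g v = (t 2 * t 3 * (t 6 + t 7) - t 6 * t 7 * (t 2 + t 3)) * x v +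
      (t 2 * t 3 - t 6 * t 7) * y v + (t 2 + t 3 - t 6 - t 7) * z v := fun v => by simp [g]
  have hg0 : g ≠ 0 := by
    intro h
    obtain ⟨v, hxv, hyv, hzv⟩ := hsurj 0 1 0
    obtain ⟨w, hxw, hyw, hzw⟩ := hsurj 0 0 1
    have h1 := hg v
    have h2 := hg w
    rw [h, hxv, hyv, hzv, LinearMap.zero_apply] at h1
    rw [h, hxw, hyw, hzw, LinearMap.zero_apply] at h2
    have h3 : (t 2 - t 6) * (t 2 - t 7) = 0 := by
      linear_combination h1 - t 2 * h2
    exact (mul_ne_zero (sub_ne_zero.2 t26) (sub_ne_zero.2 t27)) h3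
  refine ⟨{p | g p.rep = 0}, isLine_of_linearMap hg0, ?_, ?_, fun p hp₁ hp₂ hp1 hp5 => ?_⟩
  · rw [Set.mem_ofPred_eq, hg, y3, z3]
    ring
  · rw [Set.mem_ofPred_eq, hg, y7, z7]
    ring
  have e₁ : eval p.rep (tangentConic x y z (t 7) (t 3) (t 4) (t 5)) = 0 := by
    rw [hc₁, smul_eval, hp₁, mul_zero]
  have e₂ : eval p.rep (tangentConic x y z (t 2) (t 4) (t 5) (t 6)) = 0 := by
    rw [hc₂, smul_eval, hp₂, mul_zero]
  rw [eval_tangentConic] at e₁ e₂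
  have hprod : t 2 * t 7 * (t 4 * t 5 * x p.rep - z p.rep) * g p.rep = 0 := by
    rw [hg]
    linear_combination t 7 * (t 7 - t 3) * e₂ - t 2 * (t 2 - t 6) * e₁
  refine (mul_eq_zero.1 hprod).resolve_left fun h => ?_
  have hz : z p.rep = t 4 * t 5 * x p.rep := by
    have := (mul_eq_zero.1 h).resolve_left (mul_ne_zero t2_ne t7_ne)
    linear_combination -this
  -- A point of the first conic collinear with `A 1` and `A 5` is one of these two points.
  have hxy : t 4 * t 5 * (t 7 - t 3) * t 7 * (x p.rep * (y p.rep + (t 4 + t 5) * x p.rep)) = 0 := by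
    rw [hz] at e₁
    linear_combination e₁
  have hcoef : t 4 * t 5 * (t 7 - t 3) * t 7 ≠ 0 :=
    mul_ne_zero (mul_ne_zero (mul_ne_zero t4_ne t5_ne) (sub_ne_zero.2 t73)) t7_ne
  rcases mul_eq_zero.1 ((mul_eq_zero.1 hxy).resolve_left hcoef) with hx | hy
  · refine hp1 ?_
    have : p ∈ ℓ (1 - 1) ∩ ℓ 1 := ⟨(hℓ0 p).2 (by rw [hz, hx, mul_zero]), (hℓ1 p).2 hx⟩
    rwa [hA 1] at this
  · refine hp5 ?_
    have : p ∈ ℓ (5 - 1) ∩ ℓ 5 :=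
      ⟨(hℓ4 p).2 (by rw [hz]; linear_combination t 4 * hy),
        (hℓ5 p).2 (by rw [hz]; linear_combination t 5 * hy)⟩
    rwa [hA 5] at this
end
end

section
/- Let γ ⊂ ℙ² be an irreducible conic and let ℓ₁,…,ℓ₈ be eight pairwise distinct lines tangent to γ; set A_i = ℓ_{i−1} ∩ ℓ_i for i = 1,…,8 (indices mod 8, ℓ₀ = ℓ₈), so A₁,…,A₈ are the vertices of an octagon circumscribed to γ whose side through A_i and A_{i+1} is ℓ_i. Let P₁ = ℓ₈ ∩ ℓ₂, P₂ = ℓ₁ ∩ ℓ₃, P₃ = ℓ₂ ∩ ℓ₄, P₄ = ℓ₃ ∩ ℓ₅. For i = 1,…,4 suppose the space of quadratic forms vanishing at A_i, A_{i+1}, A_{i+4}, A_{i+5}, P_i (indices mod 8) is one-dimensional, spanned by q_i with zero locus γ_i. Then there exists a nonzero homogeneous quadratic form vanishing at every point of (γ₁ ∩ γ₃) ∪ (γ₂ ∩ γ₄); that is, these eight points lie on a conic. -/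
open MvPolynomial

noncomputable section

/-- A quadratic form, given as a polynomial, as a `QuadraticForm`. -/
theorem exists_quadraticForm_eval {σ : Type*} {p : MvPolynomial σ ℂ}
    (hp : p.IsHomogeneous 2) : ∃ Q : QuadraticForm ℂ (σ → ℂ), ∀ v, Q v = eval v p := by
  have key : ∀ d ∈ p.support, ∃ Q : QuadraticForm ℂ (σ → ℂ),
      ∀ v, Q v = eval v (monomial d (coeff d p)) := by
    intro d hd
    have hdeg : d.degree = 2 := by
      by_contra hne
      exact (mem_support_iff.1 hd) (hp.coeff_eq_zero hne)
    have hcard : Multiset.card (Finsupp.toMultiset d) = 2 := by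
      rw [Finsupp.card_toMultiset, ← hdeg]; rfl
    obtain ⟨i, j, hij⟩ := Multiset.card_eq_two.1 hcard
    have hd' : d = Finsupp.single i 1 + Finsupp.single j 1 := by
      classical
      refine Multiset.toFinsupp.symm.injective ?_
      simp only [Multiset.toFinsupp_symm_apply, map_add, Finsupp.toMultiset_single, one_smul]
      rw [hij]; rfl
    refine ⟨coeff d p • QuadraticMap.linMulLin (LinearMap.proj i) (LinearMap.proj j), fun v => ?_⟩
    have hmon : monomial d (coeff d p) = C (coeff d p) * (X i * X j) := by
      conv_lhs => rw [← mul_one (coeff d p), ← C_mul_monomial]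
      rw [hd', X, X, monomial_mul, one_mul]
    rw [hmon]
    simp
  choose! Q hQ using key
  refine ⟨∑ d ∈ p.support, Q d, fun v => ?_⟩
  conv_rhs => rw [p.as_sum, map_sum]
  rw [sum_apply]
  exact Finset.sum_congr rfl fun d hd => hQ d hd v

/-- The polynomial attached to a linear functional. -/
theorem exists_linear_eval {σ : Type*} [Fintype σ] (L : (σ → ℂ) →ₗ[ℂ] ℂ) :
    ∃ p : MvPolynomial σ ℂ, p.IsHomogeneous 1 ∧ ∀ v, eval v p = L v := by
  classical
  refine ⟨∑ i, C (L fun j => if i = j then 1 else 0) * X i, ?_, fun v => ?_⟩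
  · refine IsHomogeneous.sum _ _ _ fun i _ => ?_
    simpa using (isHomogeneous_C σ _).mul (isHomogeneous_X ℂ i)
  · rw [LinearMap.pi_apply_eq_sum_univ L v]
    simp [mul_comm]

theorem not_irreducible_of_eval_eq_mul {σ : Type*} [Fintype σ] {p : MvPolynomial σ ℂ}
    (L M : (σ → ℂ) →ₗ[ℂ] ℂ) (h : ∀ v, eval v p = L v * M v) : ¬ Irreducible p := by
  intro hp
  obtain ⟨l, -, hl⟩ := exists_linear_eval L
  obtain ⟨m, -, hm⟩ := exists_linear_eval M
  have hlm : p = l * m := MvPolynomial.funext fun v => by simp [h, hl, hm]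
  rcases hp.isUnit_or_isUnit hlm with hu | hu
  · exact (hu.map (eval (0 : σ → ℂ))).ne_zero (by rw [hl, map_zero])
  · exact (hu.map (eval (0 : σ → ℂ))).ne_zero (by rw [hm, map_zero])

/-- Homogeneous forms can be composed with linear maps. -/
theorem exists_eval_comp_linear {σ τ : Type*} [Fintype σ] {k : ℕ} {p : MvPolynomial τ ℂ}
    (hp : p.IsHomogeneous k) (L : (σ → ℂ) →ₗ[ℂ] (τ → ℂ)) :
    ∃ p' : MvPolynomial σ ℂ, p'.IsHomogeneous k ∧ ∀ v, eval v p' = eval (L v) p := by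
  choose l hl hlv using fun i => exists_linear_eval ((LinearMap.proj i).comp L)
  refine ⟨aeval l p, ?_, fun v => ?_⟩
  · simpa using hp.aeval l hl
  · rw [← coe_aeval_eq_eval, ← coe_aeval_eq_eval, RingHom.coe_coe, RingHom.coe_coe,
      ← AlgHom.comp_apply, comp_aeval]
    congr 2
    funext i
    simpa [coe_aeval_eq_eval] using hlv i v

/-- In suitable linear coordinates an irreducible ternary quadratic form over `ℂ` is
`y² - 4xz`. -/
theorem exists_linearEquiv_eval_eq {p : MvPolynomial (Fin 3) ℂ} (hp : p.IsHomogeneous 2)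
    (hirr : Irreducible p) : ∃ e : (Fin 3 → ℂ) ≃ₗ[ℂ] (Fin 3 → ℂ),
      ∀ v, eval (e v) p = v 1 ^ 2 - 4 * v 0 * v 2 := by
  obtain ⟨Q, hQ⟩ := exists_quadraticForm_eval hp
  obtain ⟨w, ⟨φ⟩⟩ := Q.equivalent_weightedSumSquares
  have h3 : Module.finrank ℂ (Fin 3 → ℂ) = 3 := by simp
  generalize Module.finrank ℂ (Fin 3 → ℂ) = n at w φ h3
  subst h3
  have hφ : ∀ v, eval v p = w 0 * φ v 0 ^ 2 + w 1 * φ v 1 ^ 2 + w 2 * φ v 2 ^ 2 := by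
    intro v
    rw [← hQ, ← φ.map_app v, QuadraticMap.weightedSumSquares_apply, Fin.sum_univ_three]
    simp [pow_two]
  choose r hr using fun i => IsAlgClosed.exists_pow_nat_eq (w i) (n := 2) two_pos
  let φ' : Fin 3 → (Fin 3 → ℂ) →ₗ[ℂ] ℂ := fun i =>
    (LinearMap.proj i).comp φ.toLinearEquiv.toLinearMap
  have hφ' : ∀ i v, φ' i v = φ v i := fun i v => rfl
  have split : ∀ i j : Fin 3,
      (∀ v, eval v p = w i * φ v i ^ 2 + w j * φ v j ^ 2) → False := by
    intro i j h
    refine not_irreducible_of_eval_eq_mul (r i • φ' i + (Complex.I * r j) • φ' j)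
      (r i • φ' i - (Complex.I * r j) • φ' j) (fun v => ?_) hirr
    simp only [h, ← hr, LinearMap.add_apply, LinearMap.sub_apply, LinearMap.smul_apply, hφ',
      smul_eq_mul]
    linear_combination (r j ^ 2 * φ v j ^ 2) * Complex.I_sq
  have hr0 : ∀ i, r i ≠ 0 := by
    intro i hi
    have hw : w i = 0 := by rw [← hr, hi]; simp
    fin_cases i
    · exact split 1 2 fun v => by
        rw [hφ]; simp only [Fin.zero_eta] at hw; rw [hw]; ring
    · exact split 0 2 fun v => by
        rw [hφ]; simp only [Fin.mk_one] at hw; rw [hw]; ring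
    · exact split 0 1 fun v => by
        rw [hφ]; simp only [Fin.reduceFinMk] at hw; rw [hw]; ring
  let f : (Fin 3 → ℂ) →ₗ[ℂ] (Fin 3 → ℂ) :=
    { toFun := fun v => ![(v 0 - v 2) / r 0, v 1 / r 1, Complex.I * (v 0 + v 2) / r 2]
      map_add' := by
        intro u v
        ext i
        fin_cases i <;> simp <;> ring
      map_smul' := by
        intro c v
        ext i
        fin_cases i <;> simp <;> ring }
  have hf : ∀ v, f v = ![(v 0 - v 2) / r 0, v 1 / r 1, Complex.I * (v 0 + v 2) / r 2] :=
    fun v => rfl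
  have hinj : Function.Injective f := by
    rw [← LinearMap.ker_eq_bot, LinearMap.ker_eq_bot']
    intro v hv
    rw [hf] at hv
    have h0 := congrFun hv 0
    have h1 := congrFun hv 1
    have h2 := congrFun hv 2
    simp [hr0] at h0 h1 h2
    ext i
    fin_cases i
    · simp only [Fin.zero_eta, Pi.zero_apply]; linear_combination (h0 + h2) / 2
    · simpa using h1
    · simp only [Fin.reduceFinMk, Pi.zero_apply]; linear_combination (h2 - h0) / 2
  refine ⟨(LinearEquiv.ofInjectiveEndo f hinj).trans φ.toLinearEquiv.symm, fun v => ?_⟩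
  have hφe : φ ((LinearEquiv.ofInjectiveEndo f hinj).trans φ.toLinearEquiv.symm v) = f v :=
    φ.toLinearEquiv.apply_symm_apply (f v)
  rw [hφ, hφe, hf, ← hr, ← hr, ← hr]
  have h0 := hr0 0
  have h1 := hr0 1
  have h2 := hr0 2
  simp
  field_simp
  linear_combination (v 0 + v 2) ^ 2 * Complex.I_sq

/-- A binary quadratic form with at most one projective root is, up to sign, the square of
a linear form. -/
theorem exists_sq_of_unique_root {a b c : ℂ}
    (h : ∀ s t s' t' : ℂ, (s, t) ≠ 0 → (s', t') ≠ 0 →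
      a * s ^ 2 + 2 * b * s * t + c * t ^ 2 = 0 →
      a * s' ^ 2 + 2 * b * s' * t' + c * t' ^ 2 = 0 → s * t' = s' * t) :
    ∃ m n : ℂ, a = m ^ 2 ∧ b = - (m * n) ∧ c = n ^ 2 := by
  have hdisc : b ^ 2 = a * c := by
    by_cases ha : a = 0
    · subst ha
      by_contra hb
      have hb0 : b ≠ 0 := fun h0 => hb (by simp [h0])
      have := h 1 0 (-c) (2 * b) (by simp) (by simp [hb0]) (by ring) (by ring)
      simp [hb0] at this
    · obtain ⟨d, hd⟩ := IsAlgClosed.exists_pow_nat_eq (b ^ 2 - a * c) (n := 2) two_pos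
      have := h (-b + d) a (-b - d) a (by simp [ha]) (by simp [ha])
        (by linear_combination a * hd) (by linear_combination a * hd)
      have hd0 : d = 0 := by
        have h2 := mul_right_cancel₀ ha this
        linear_combination h2 / 2
      rw [hd0] at hd
      linear_combination -hd
  obtain ⟨m, hm⟩ := IsAlgClosed.exists_pow_nat_eq a (n := 2) two_pos
  obtain ⟨n, hn⟩ := IsAlgClosed.exists_pow_nat_eq c (n := 2) two_pos
  have hsq : b ^ 2 = (m * n) ^ 2 := by rw [hdisc, ← hm, ← hn]; ring
  rcases sq_eq_sq_iff_eq_or_eq_neg.1 hsq with hb | hb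
  · exact ⟨m, -n, hm.symm, by rw [hb]; ring, by rw [← hn]; ring⟩
  · exact ⟨m, n, hm.symm, hb, hn.symm⟩

/-- In coordinates where the conic is `y² = 4xz`, a tangent line has the equation
`m²x - mny + n²z = 0`. -/
theorem exists_tangent_equation {p : MvPolynomial (Fin 3) ℂ}
    {e : (Fin 3 → ℂ) ≃ₗ[ℂ] (Fin 3 → ℂ)}
    (he : ∀ v, eval (e v) p = v 1 ^ 2 - 4 * v 0 * v 2)
    {L : Set P2} (hL : IsLine L) (ht : IsTangent L {x : P2 | eval x.rep p = 0}) :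
    ∃ m n : ℂ, (m, n) ≠ 0 ∧ L = {x : P2 | m ^ 2 * e.symm x.rep 0 - m * n * e.symm x.rep 1
      + n ^ 2 * e.symm x.rep 2 = 0} := by
  obtain ⟨a, ha, rfl⟩ := hL
  obtain ⟨x₀, hx₀⟩ := ht
  let φ : (Fin 3 → ℂ) →ₗ[ℂ] ℂ := (∑ i, a i • LinearMap.proj i) ∘ₗ e.toLinearMap
  have hφ : ∀ v, φ v = ∑ i, a i * e v i := fun v => by simp [φ]
  obtain ⟨b, hb⟩ : ∃ b : Fin 3 → ℂ, ∀ v, ∑ i, a i * e v i = b 0 * v 0 + b 1 * v 1 + b 2 * v 2 :=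
    ⟨fun i => φ fun j => if i = j then 1 else 0, fun v => by
      rw [← hφ, LinearMap.pi_apply_eq_sum_univ φ v, Fin.sum_univ_three]
      simp only [smul_eq_mul]
      ring⟩
  have hb0 : b ≠ 0 := by
    rintro rfl
    apply ha
    ext i
    have := hb (e.symm (Pi.single i 1))
    simpa [Pi.single_apply] using this
  have hmem : ∀ (v : Fin 3 → ℂ) (hv : e v ≠ 0), v 1 ^ 2 - 4 * v 0 * v 2 = 0 →
      b 0 * v 0 + b 1 * v 1 + b 2 * v 2 = 0 → Projectivization.mk ℂ (e v) hv = x₀ := by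
    intro v hv h1 h2
    rw [← Set.mem_singleton_iff, ← hx₀]
    obtain ⟨c, hc⟩ := Projectivization.exists_smul_eq_mk_rep ℂ (e v) hv
    have hc' : (Projectivization.mk ℂ (e v) hv).rep = e ((c : ℂ) • v) := by
      rw [← hc, map_smul]; rfl
    constructor
    · simp only [Set.mem_ofPred_eq, hc', hb, Pi.smul_apply, smul_eq_mul]
      linear_combination (c : ℂ) * h2
    · simp only [Set.mem_ofPred_eq, hc', he, Pi.smul_apply, smul_eq_mul]
      linear_combination (c : ℂ) ^ 2 * h1
  obtain ⟨m, n, h0, h1, h2⟩ := exists_sq_of_unique_root (a := b 0) (b := b 1) (c := b 2) (by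
    intro s t s' t' hst hst' hr hr'
    have hne : ∀ s t : ℂ, (s, t) ≠ 0 → e ![s ^ 2, 2 * s * t, t ^ 2] ≠ 0 := by
      intro s t hst h
      rw [LinearEquiv.map_eq_zero_iff] at h
      have h0 := congrFun h 0
      have h2 := congrFun h 2
      simp at h0 h2
      exact hst (by simp [h0, h2])
    have hx := hmem _ (hne s t hst) (by simp; ring) (by simp; linear_combination hr)
    have hx' := hmem _ (hne s' t' hst') (by simp; ring) (by simp; linear_combination hr')
    rw [← hx', Projectivization.mk_eq_mk_iff'] at hx
    obtain ⟨c, hc⟩ := hx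
    rw [← map_smul, e.injective.eq_iff] at hc
    have h0 := congrFun hc 0
    have h1 := congrFun hc 1
    have h2 := congrFun hc 2
    simp at h0 h1 h2
    have : (s * t' - s' * t) ^ 2 = 0 := by
      linear_combination -t' ^ 2 * h0 - s' ^ 2 * h2 + s' * t' * h1
    exact sub_eq_zero.1 (pow_eq_zero_iff two_ne_zero |>.1 this))
  refine ⟨m, n, ?_, ?_⟩
  · intro h
    simp only [Prod.mk_eq_zero] at h
    apply hb0
    ext i
    fin_cases i <;> simp [h0, h1, h2, h.1, h.2]
  · ext x
    have := hb (e.symm x.rep)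
    rw [e.apply_symm_apply, h0, h1, h2] at this
    simp only [Set.mem_ofPred_eq, this]
    constructor <;> intro h <;> linear_combination h

/-- The Bezoutian of two binary cubics, as a quadratic form in the elementary symmetric
functions `(1, s + t, st)` of its two arguments. -/
def bezoutian (f g : Fin 4 → ℂ) : MvPolynomial (Fin 3) ℂ :=
  C (f 1 * g 0 - f 0 * g 1) * X 0 ^ 2 + C (f 2 * g 0 - f 0 * g 2) * (X 0 * X 1)
    + C (f 3 * g 0 - f 0 * g 3) * (X 1 ^ 2 - X 0 * X 2)
    + C (f 2 * g 1 - f 1 * g 2) * (X 0 * X 2) + C (f 3 * g 1 - f 1 * g 3) * (X 1 * X 2)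
    + C (f 3 * g 2 - f 2 * g 3) * X 2 ^ 2

theorem isHomogeneous_bezoutian (f g : Fin 4 → ℂ) : (bezoutian f g).IsHomogeneous 2 := by
  have hC : ∀ (c : ℂ) {p : MvPolynomial (Fin 3) ℂ}, p.IsHomogeneous 2 →
      (C c * p).IsHomogeneous 2 := fun c p hp => hp.C_mul c
  have hX : ∀ i j : Fin 3, (X i * X j : MvPolynomial (Fin 3) ℂ).IsHomogeneous 2 :=
    fun i j => (isHomogeneous_X ℂ i).mul (isHomogeneous_X ℂ j)
  simp only [bezoutian, pow_two]
  exact (((((hC _ (hX 0 0)).add (hC _ (hX 0 1))).add (hC _ ((hX 1 1).sub (hX 0 2)))).add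
    (hC _ (hX 0 2))).add (hC _ (hX 1 2))).add (hC _ (hX 2 2))

theorem eval_bezoutian (f g : Fin 4 → ℂ) (v : Fin 3 → ℂ) :
    eval v (bezoutian f g) =
      (f 1 * g 0 - f 0 * g 1) * v 0 ^ 2 + (f 2 * g 0 - f 0 * g 2) * (v 0 * v 1)
        + (f 3 * g 0 - f 0 * g 3) * (v 1 ^ 2 - v 0 * v 2)
        + (f 2 * g 1 - f 1 * g 2) * (v 0 * v 2) + (f 3 * g 1 - f 1 * g 3) * (v 1 * v 2)
        + (f 3 * g 2 - f 2 * g 3) * v 2 ^ 2 := by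
  simp [bezoutian]

section Tangents

variable {ι : Type*} (m n : ι → ℂ)

/-- The bracket of two points of the projective line. -/
def bracket (i j : ι) : ℂ := m i * n j - m j * n i

/-- The intersection point of two tangents of the conic `y² = 4xz`. -/
def meet (i j : ι) : Fin 3 → ℂ := ![n i * n j, m i * n j + m j * n i, m i * m j]

/-- The coefficients of the binary cubic with three given roots. -/
def cubic (a b c : ι) : Fin 4 → ℂ :=
  ![-(m a * m b * m c), n a * m b * m c + m a * n b * m c + m a * m b * n c,
    -(n a * n b * m c + n a * m b * n c + m a * n b * n c), n a * n b * n c]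

theorem bracket_mul_eval_meet (a b c a' b' c' i j : ι) :
    bracket m n i j * eval (meet m n i j) (bezoutian (cubic m n a b c) (cubic m n a' b' c')) =
      bracket m n i a * bracket m n i b * bracket m n i c *
          (bracket m n j a' * bracket m n j b' * bracket m n j c') -
        bracket m n j a * bracket m n j b * bracket m n j c *
          (bracket m n i a' * bracket m n i b' * bracket m n i c') := by
  have hbez : ∀ f g : Fin 4 → ℂ, bracket m n i j * eval (meet m n i j) (bezoutian f g) =
      (f 0 * n i ^ 3 + f 1 * m i * n i ^ 2 + f 2 * m i ^ 2 * n i + f 3 * m i ^ 3) *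
        (g 0 * n j ^ 3 + g 1 * m j * n j ^ 2 + g 2 * m j ^ 2 * n j + g 3 * m j ^ 3) -
      (f 0 * n j ^ 3 + f 1 * m j * n j ^ 2 + f 2 * m j ^ 2 * n j + f 3 * m j ^ 3) *
        (g 0 * n i ^ 3 + g 1 * m i * n i ^ 2 + g 2 * m i ^ 2 * n i + g 3 * m i ^ 3) := by
    intro f g
    simp [eval_bezoutian, bracket, meet]
    ring
  have hcub : ∀ a b c i : ι, cubic m n a b c 0 * n i ^ 3 + cubic m n a b c 1 * m i * n i ^ 2 +
      cubic m n a b c 2 * m i ^ 2 * n i + cubic m n a b c 3 * m i ^ 3 =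
      bracket m n i a * bracket m n i b * bracket m n i c := by
    intro a b c i
    simp [cubic, bracket]
    ring
  rw [hbez, hcub, hcub, hcub, hcub]

/-- The linear relation between the Bezoutians attached to the four pairs of opposite
triangles of an octagon. -/
theorem bezoutian_octagon_relation (m n : Fin 8 → ℂ) (v : Fin 3 → ℂ) :
    bracket m n 2 6 * eval v (bezoutian (cubic m n 7 0 1) (cubic m n 3 4 5)) -
        bracket m n 0 4 * eval v (bezoutian (cubic m n 1 2 3) (cubic m n 5 6 7)) =
      bracket m n 1 5 * eval v (bezoutian (cubic m n 2 3 4) (cubic m n 6 7 0)) -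
        bracket m n 3 7 * eval v (bezoutian (cubic m n 0 1 2) (cubic m n 4 5 6)) := by
  simp only [eval_bezoutian, cubic, bracket, Matrix.cons_val]
  ring

end Tangents

/-- Two distinct tangents have nonzero bracket. -/
theorem bracket_ne_zero {ι : Type*} {m n : ι → ℂ} {ℓ : ι → Set P2} (hinj : Function.Injective ℓ)
    {f : P2 → Fin 3 → ℂ} (hmn : ∀ i, (m i, n i) ≠ 0)
    (hℓ : ∀ i, ℓ i = {x : P2 | m i ^ 2 * f x 0 - m i * n i * f x 1 + n i ^ 2 * f x 2 = 0})
    {i j : ι} (hij : i ≠ j) : bracket m n i j ≠ 0 := by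
  intro h
  obtain ⟨c, hc, hm, hn⟩ : ∃ c : ℂ, c ≠ 0 ∧ m j = c * m i ∧ n j = c * n i := by
    have hi := hmn i
    have hj := hmn j
    simp only [ne_eq, Prod.mk_eq_zero, not_and_or] at hi hj
    unfold bracket at h
    by_cases hmi : m i = 0
    · have hni : n i ≠ 0 := by tauto
      have hmj : m j = 0 := by simpa [hmi, hni] using h
      have hnj : n j ≠ 0 := by tauto
      exact ⟨n j / n i, div_ne_zero hnj hni, by simp [hmi, hmj], by field_simp⟩
    · have hn : n j = m j / m i * n i := by
        field_simp
        linear_combination h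
      have hmj : m j ≠ 0 := by
        intro h0
        simp [h0] at hn
        tauto
      exact ⟨m j / m i, div_ne_zero hmj hmi, by field_simp, hn⟩
  apply hij
  apply hinj
  rw [hℓ, hℓ]
  ext x
  simp only [Set.mem_ofPred_eq, hm, hn]
  rw [show (c * m i) ^ 2 * f x 0 - c * m i * (c * n i) * f x 1 + (c * n i) ^ 2 * f x 2 =
    c ^ 2 * (m i ^ 2 * f x 0 - m i * n i * f x 1 + n i ^ 2 * f x 2) by ring]
  simp [hc]

/-- Two tangents whose intersection is a single point meet at the expected point. -/
theorem exists_rep_eq_smul_meet {ι : Type*} {m n : ι → ℂ} {ℓ : ι → Set P2}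
    {e : (Fin 3 → ℂ) ≃ₗ[ℂ] (Fin 3 → ℂ)}
    (hℓ : ∀ i, ℓ i = {x : P2 | m i ^ 2 * e.symm x.rep 0 - m i * n i * e.symm x.rep 1
      + n i ^ 2 * e.symm x.rep 2 = 0})
    {i j : ι} (hij : bracket m n i j ≠ 0) {x : P2} (hx : ℓ i ∩ ℓ j = {x}) :
    ∃ c : ℂ, e.symm x.rep = c • meet m n i j := by
  have hne : e (meet m n i j) ≠ 0 := by
    rw [Ne, LinearEquiv.map_eq_zero_iff]
    intro h
    have h0 := congrFun h 0
    have h1 := congrFun h 1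
    have h2 := congrFun h 2
    simp only [meet, Matrix.cons_val, Pi.zero_apply] at h0 h1 h2
    apply hij
    rw [← sq_eq_zero_iff, bracket]
    linear_combination (m i * n j + m j * n i) * h1 - 4 * m i * m j * h0
  obtain ⟨c, hc⟩ := Projectivization.exists_smul_eq_mk_rep ℂ _ hne
  have hrep : e.symm (Projectivization.mk ℂ _ hne).rep = (c : ℂ) • meet m n i j := by
    rw [← hc, Units.smul_def, map_smul, e.symm_apply_apply]
  have hmem : Projectivization.mk ℂ _ hne ∈ ℓ i ∩ ℓ j := by
    rw [hℓ, hℓ, Set.mem_inter_iff, Set.mem_ofPred_eq, Set.mem_ofPred_eq, hrep]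
    constructor <;>
    · simp only [meet, Pi.smul_apply, smul_eq_mul, Matrix.cons_val]
      ring
  rw [hx, Set.mem_singleton_iff] at hmem
  exact ⟨c, hmem ▸ hrep⟩

/-- The Bezoutian attached to the triangles of consecutive sides centred at `i` and `i + 4`
of an octagon. -/
def octagonBezoutian (m n : Fin 8 → ℂ) (i : Fin 8) : MvPolynomial (Fin 3) ℂ :=
  bezoutian (cubic m n (i - 1) i (i + 1)) (cubic m n (i + 3) (i + 4) (i + 5))

theorem isHomogeneous_octagonBezoutian (m n : Fin 8 → ℂ) (i : Fin 8) :
    (octagonBezoutian m n i).IsHomogeneous 2 :=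
  isHomogeneous_bezoutian _ _

theorem eval_meet_octagonBezoutian {m n : Fin 8 → ℂ}
    (hmn : ∀ i j, i ≠ j → bracket m n i j ≠ 0) (i : Fin 8) {a b : Fin 8}
    (h : (a, b) ∈ ({(i - 1, i), (i, i + 1), (i + 3, i + 4), (i + 4, i + 5), (i - 1, i + 1)} :
      Set (Fin 8 × Fin 8))) :
    eval (meet m n a b) (octagonBezoutian m n i) = 0 := by
  have hself : ∀ j, bracket m n j j = 0 := fun j => sub_self _
  have hab : a ≠ b := by
    have hne : ∀ i : Fin 8, i - 1 ≠ i ∧ i ≠ i + 1 ∧ i + 3 ≠ i + 4 ∧ i + 4 ≠ i + 5 ∧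
      i - 1 ≠ i + 1 := by decide
    obtain ⟨h1, h2, h3, h4, h5⟩ := hne i
    simp only [Set.mem_insert_iff, Set.mem_singleton_iff, Prod.mk.injEq] at h
    rcases h with ⟨ha, hb⟩ | ⟨ha, hb⟩ | ⟨ha, hb⟩ | ⟨ha, hb⟩ | ⟨ha, hb⟩ <;> rw [ha, hb] <;>
      assumption
  have key := bracket_mul_eval_meet m n (i - 1) i (i + 1) (i + 3) (i + 4) (i + 5) a b
  refine (mul_eq_zero.1 (key.trans ?_)).resolve_left (hmn a b hab)
  simp only [Set.mem_insert_iff, Set.mem_singleton_iff, Prod.mk.injEq] at h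
  rcases h with ⟨ha, hb⟩ | ⟨ha, hb⟩ | ⟨ha, hb⟩ | ⟨ha, hb⟩ | ⟨ha, hb⟩ <;> simp [ha, hb, hself]

/-- **Eight points from an octagon circumscribed to a conic lie on a conic.**
Let `ℓ₀,…,ℓ₇` (indices mod 8) be eight pairwise distinct lines tangent to an irreducible
conic `γ`, with vertices `A i = ℓ (i−1) ∩ ℓ i`.  For `k = 0,…,3` let
`Pt k = ℓ (k−1) ∩ ℓ (k+1)` (these are the paper's `P₁,…,P₄`) and suppose the quadratic
forms through `A k, A (k+1), A (k+4), A (k+5), Pt k` form a one-dimensional space spanned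
by `q k`, with zero locus `γ_k`.  Then the eight points `(γ₀ ∩ γ₂) ∪ (γ₁ ∩ γ₃)` lie on a
conic. -/
theorem octagon_eight_points_on_conic
    (γ : Set P2) (hγ : IsIrredConic γ) (ℓ : Fin 8 → Set P2)
    (hline : ∀ i, IsLine (ℓ i)) (htan : ∀ i, IsTangent (ℓ i) γ)
    (hinj : Function.Injective ℓ)
    (A : Fin 8 → P2) (hA : ∀ i : Fin 8, ℓ (i - 1) ∩ ℓ i = {A i})
    (Pt : Fin 4 → P2)
    (hPt : ∀ k : Fin 4, ℓ ((⟨k.1, by omega⟩ : Fin 8) - 1) ∩ ℓ ((⟨k.1, by omega⟩ : Fin 8) + 1)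
      = {Pt k})
    (q : Fin 4 → MvPolynomial (Fin 3) ℂ)
    (hq0 : ∀ k, q k ≠ 0) (hq2 : ∀ k, (q k).IsHomogeneous 2)
    (hqv : ∀ k : Fin 4, ∀ p ∈ ({A ⟨k.1, by omega⟩, A ((⟨k.1, by omega⟩ : Fin 8) + 1),
        A ((⟨k.1, by omega⟩ : Fin 8) + 4), A ((⟨k.1, by omega⟩ : Fin 8) + 5), Pt k} : Set P2),
      eval p.rep (q k) = 0)
    (hqspan : ∀ k : Fin 4, ∀ q' : MvPolynomial (Fin 3) ℂ, q'.IsHomogeneous 2 →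
      (∀ p ∈ ({A ⟨k.1, by omega⟩, A ((⟨k.1, by omega⟩ : Fin 8) + 1),
          A ((⟨k.1, by omega⟩ : Fin 8) + 4), A ((⟨k.1, by omega⟩ : Fin 8) + 5),
          Pt k} : Set P2), eval p.rep q' = 0) → ∃ c : ℂ, q' = c • q k) :
    ∃ Q : MvPolynomial (Fin 3) ℂ, Q ≠ 0 ∧ Q.IsHomogeneous 2 ∧
      ∀ p : P2, ((eval p.rep (q 0) = 0 ∧ eval p.rep (q 2) = 0) ∨
          (eval p.rep (q 1) = 0 ∧ eval p.rep (q 3) = 0)) → eval p.rep Q = 0 := by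
  obtain ⟨g, hg2, hgirr, rfl⟩ := hγ
  obtain ⟨e, he⟩ := exists_linearEquiv_eval_eq hg2 hgirr
  choose m n hmn0 hℓ using fun i => exists_tangent_equation he (hline i) (htan i)
  have hmn : ∀ i j, i ≠ j → bracket m n i j ≠ 0 := fun i j hij =>
    bracket_ne_zero hinj (f := fun x => e.symm x.rep) hmn0 hℓ hij
  have hvert : ∀ {i j : Fin 8} {x : P2}, i ≠ j → ℓ i ∩ ℓ j = {x} →
      ∃ c : ℂ, e.symm x.rep = c • meet m n i j :=
    fun hij hx => exists_rep_eq_smul_meet hℓ (hmn _ _ hij) hx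
  have hpred : ∀ i : Fin 8, i - 1 ≠ i := by decide
  have hidx : ∀ i : Fin 8, i + 1 - 1 = i ∧ i + 4 - 1 = i + 3 ∧ i + 5 - 1 = i + 4 ∧
      i - 1 ≠ i + 1 := by decide
  have heval : ∀ {p : MvPolynomial (Fin 3) ℂ}, p.IsHomogeneous 2 → ∀ {u v : Fin 3 → ℂ},
      eval v p = 0 → (∃ c : ℂ, u = c • v) → eval u p = 0 := by
    rintro p hp _ v h ⟨c, rfl⟩
    obtain ⟨Q, hQ⟩ := exists_quadraticForm_eval hp
    rw [← hQ, QuadraticMap.map_smul, hQ, h, smul_zero]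
  have hzero : ∀ (k : Fin 4) (x : P2), eval x.rep (q k) = 0 →
      eval (e.symm x.rep) (octagonBezoutian m n ⟨k.1, by omega⟩) = 0 := by
    intro k x hx
    obtain ⟨p, hp2, hp⟩ := exists_eval_comp_linear
      (isHomogeneous_octagonBezoutian m n ⟨k.1, by omega⟩)
      e.symm.toLinearMap
    simp only [LinearEquiv.coe_coe] at hp
    obtain ⟨c, hc⟩ := hqspan k p hp2 (by
      intro y hy
      have hPk := hPt k
      rw [hp]
      generalize (⟨k.1, by omega⟩ : Fin 8) = i at hy hPk ⊢
      have hz : ∀ {a b : Fin 8}, (∃ c : ℂ, e.symm y.rep = c • meet m n a b) →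
          (a, b) ∈ ({(i - 1, i), (i, i + 1), (i + 3, i + 4), (i + 4, i + 5), (i - 1, i + 1)} :
            Set (Fin 8 × Fin 8)) → eval (e.symm y.rep) (octagonBezoutian m n i) = 0 :=
        fun hy hab => heval (isHomogeneous_octagonBezoutian m n i)
          (eval_meet_octagonBezoutian hmn i hab) hy
      obtain ⟨h1, h4, h5, hi⟩ := hidx i
      rcases hy with rfl | rfl | rfl | rfl | rfl
      · exact hz (hvert (hpred _) (hA _)) (by simp)
      · exact hz (hvert (hpred _) (hA _)) (by simp [h1])
      · exact hz (hvert (hpred _) (hA _)) (by simp [h4])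
      · exact hz (hvert (hpred _) (hA _)) (by simp [h5])
      · exact hz (hvert hi hPk) (by simp))
    rw [← hp, hc, smul_eval, hx, mul_zero]
  obtain ⟨Q, hQ2, hQ⟩ := exists_eval_comp_linear
    (((isHomogeneous_octagonBezoutian m n 0).C_mul (bracket m n 2 6)).sub
      ((isHomogeneous_octagonBezoutian m n 2).C_mul (bracket m n 0 4)))
    e.symm.toLinearMap
  simp only [LinearEquiv.coe_coe, map_sub, map_mul, eval_C] at hQ
  refine ⟨Q, ?_, hQ2, ?_⟩
  · rintro rfl
    have h := hQ (e (meet m n 7 0))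
    rw [e.symm_apply_apply, map_zero,
      eval_meet_octagonBezoutian hmn 0 (show ((7 : Fin 8), (0 : Fin 8)) ∈ _ from Or.inl rfl)] at h
    have h2 : eval (meet m n 7 0) (octagonBezoutian m n 2) = 0 := by
      simpa [hmn 0 4 (by decide)] using h
    have key := bracket_mul_eval_meet m n 1 2 3 5 6 7 7 0
    have hself : bracket m n 7 7 = 0 := sub_self _
    have h2' : eval (meet m n 7 0) (bezoutian (cubic m n 1 2 3) (cubic m n 5 6 7)) = 0 := h2
    rw [h2', hself] at key
    simp [hmn] at key
  · rintro x (⟨h0, h2⟩ | ⟨h1, h3⟩)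
    · have h0' : eval (e.symm x.rep) (octagonBezoutian m n 0) = 0 := hzero 0 x h0
      have h2' : eval (e.symm x.rep) (octagonBezoutian m n 2) = 0 := hzero 2 x h2
      rw [hQ, h0', h2']
      simp
    · rw [hQ]
      refine (bezoutian_octagon_relation m n (e.symm x.rep)).trans ?_
      have h1' : eval (e.symm x.rep) (bezoutian (cubic m n 0 1 2) (cubic m n 4 5 6)) = 0 :=
        hzero 1 x h1
      have h3' : eval (e.symm x.rep) (bezoutian (cubic m n 2 3 4) (cubic m n 6 7 0)) = 0 :=
        hzero 3 x h3
      rw [h1', h3']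
      simp

end
end
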